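/- Let α_t denote the largest zero of the derivative of the Legendre polynomial P_{t+1}^{(d)}. Then every spherical t-design X_N on S^d with N points satisfies Yudin's bound N ≥ [∫_{-1}^{1} (1-x²)^{d/2-1} dx] / [∫_{α_t}^{1} (1-x²)^{d/2-1} dx], i.e. N ≥ 1/σ_d({y ∈ S^d : ⟨y, x⟩ ≥ α_t}) for any fixed x ∈ S^d. -/

import Mathlib

open MeasureTheory

/-- The normalised surface area measure `σ_d` on the unit sphere `S^d ⊂ ℝ^{d+1}`. -/
noncomputable def sphereMeasure (d : ℕ) :
    Measure (EuclideanSpace ℝ (Fin (d + 1))) :=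
  (μH[(d : ℝ)] (Metric.sphere (0 : EuclideanSpace ℝ (Fin (d + 1))) 1))⁻¹ •
    (μH[(d : ℝ)]).restrict (Metric.sphere (0 : EuclideanSpace ℝ (Fin (d + 1))) 1)

/-- A finite set `X ⊂ S^d` is a spherical `t`-design if the equal-weight average over `X`
of every polynomial of total degree at most `t` equals its integral over `S^d`. -/
def IsSphericalDesign (d t : ℕ) (X : Finset (EuclideanSpace ℝ (Fin (d + 1)))) : Prop :=
  ∀ p : MvPolynomial (Fin (d + 1)) ℝ, p.totalDegree ≤ t →
    (X.card : ℝ)⁻¹ * ∑ x ∈ X, MvPolynomial.eval (fun i => x i) p =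
      ∫ y, MvPolynomial.eval (fun i => y i) p ∂(sphereMeasure d)

/-- The Legendre polynomial `P_ℓ^{(d)}` for the sphere `S^d`, normalised so that
`P_ℓ^{(d)}(1) = 1`. -/
noncomputable def legendreP (d : ℕ) : ℕ → ℝ → ℝ
  | 0 => fun _ => 1
  | 1 => fun x => x
  | n + 2 => fun x =>
      ((2 * (n : ℝ) + d + 1) * x * legendreP d (n + 1) x - ((n : ℝ) + 1) * legendreP d n x)
        / ((n : ℝ) + d)

section SphereMeas

lemma yu_normalize_lip {E : Type*} [NormedAddCommGroup E] [NormedSpace ℝ E] :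
    LipschitzOnWith 2 (fun x : E => ‖x‖⁻¹ • x) {x | 1 ≤ ‖x‖} := by
  refine LipschitzOnWith.of_dist_le_mul ?_
  intro x hx y hy
  simp only [Set.mem_ofPred_eq] at hx hy
  have hx0 : 0 < ‖x‖ := by linarith
  have hy0 : 0 < ‖y‖ := by linarith
  rw [dist_eq_norm, dist_eq_norm]
  have h1 : ‖x‖⁻¹ • x - ‖y‖⁻¹ • y = ‖x‖⁻¹ • (x - y) + (‖x‖⁻¹ * (‖y‖ - ‖x‖) * ‖y‖⁻¹) • y := by
    have : ‖x‖⁻¹ * (‖y‖ - ‖x‖) * ‖y‖⁻¹ = ‖x‖⁻¹ - ‖y‖⁻¹ := by field_simp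
    rw [this, smul_sub, sub_smul]; abel
  rw [h1]
  have hi : ‖x‖⁻¹ ≤ 1 := inv_le_one_of_one_le₀ hx
  calc _ ≤ ‖‖x‖⁻¹ • (x - y)‖ + ‖(‖x‖⁻¹ * (‖y‖ - ‖x‖) * ‖y‖⁻¹) • y‖ := norm_add_le _ _
    _ = ‖x‖⁻¹ * ‖x - y‖ + ‖x‖⁻¹ * |‖y‖ - ‖x‖| := by
        rw [norm_smul, norm_smul, norm_mul, norm_mul, norm_inv, norm_inv, norm_norm, norm_norm,
          Real.norm_eq_abs]
        field_simp
    _ ≤ 1 * ‖x - y‖ + 1 * ‖x - y‖ := by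
        have := abs_norm_sub_norm_le y x
        rw [norm_sub_rev y x] at this
        gcongr
    _ = _ := by push_cast; ring

lemma yu_face_lip (d : ℕ) (i : Fin (d + 1)) (e : ℝ) : ∃ K : NNReal, LipschitzWith K
    (fun v : Fin d → ℝ => WithLp.toLp 2 (i.insertNth (α := fun _ => ℝ) e v)) := by
  have h1 : LipschitzWith 1 (fun v : Fin d → ℝ => i.insertNth (α := fun _ => ℝ) e v) := by
    refine LipschitzWith.of_dist_le_mul fun v w => ?_
    rw [NNReal.coe_one, one_mul]
    refine (dist_pi_le_iff dist_nonneg).2 fun j => ?_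
    rcases Fin.eq_self_or_eq_succAbove i j with rfl | ⟨k, rfl⟩
    · simp
    · simpa using dist_le_pi_dist v w k
  exact ⟨_, (PiLp.lipschitzWith_toLp 2 (fun _ : Fin (d+1) => ℝ)).comp h1⟩

lemma yu_sphere_cover (d : ℕ) (x : EuclideanSpace ℝ (Fin (d + 1))) (hx : ‖x‖ = 1) :
    ∃ (i : Fin (d + 1)) (e : ℝ) (v : Fin d → ℝ), (e = 1 ∨ e = -1) ∧ v ∈ Set.Icc (-1) 1 ∧
      (‖(WithLp.toLp 2 (i.insertNth (α := fun _ => ℝ) e v) : EuclideanSpace ℝ (Fin (d + 1)))‖⁻¹ •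
        (WithLp.toLp 2 (i.insertNth (α := fun _ => ℝ) e v) : EuclideanSpace ℝ (Fin (d + 1)))) = x := by
  obtain ⟨i, hi⟩ := Finite.exists_max (fun i => |x i|)
  have hpos : 0 < |x i| := by
    by_contra h
    have h0 : ∀ j, x j = 0 := fun j => abs_eq_zero.1 (le_antisymm ((hi j).trans (not_lt.1 h)) (abs_nonneg _))
    have : x = 0 := by ext j; simpa using h0 j
    rw [this] at hx; simp at hx
  have hz : (WithLp.toLp 2 (i.insertNth (α := fun _ => ℝ) (x i / |x i|) (fun k => x (i.succAbove k) / |x i|)) :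
      EuclideanSpace ℝ (Fin (d + 1))) = |x i|⁻¹ • x := by
    ext j
    rcases Fin.eq_self_or_eq_succAbove i j with rfl | ⟨k, rfl⟩
    · simp [div_eq_inv_mul]
    · simp [div_eq_inv_mul]
  refine ⟨i, x i / |x i|, fun k => x (i.succAbove k) / |x i|, ?_, ?_, ?_⟩
  · rcases abs_choice (x i) with h | h
    · left; rw [h]; rw [h] at hpos; field_simp
    · right; rw [h]; rw [h] at hpos
      have : x i ≠ 0 := by intro h0; simp [h0] at hpos
      field_simp
  · have : ∀ k, abs (x (i.succAbove k) / |x i|) ≤ 1 := by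
      intro k; rw [abs_div, abs_abs]; exact div_le_one_of_le₀ (hi _) (abs_nonneg _)
    exact ⟨fun k => (abs_le.1 (this k)).1, fun k => (abs_le.1 (this k)).2⟩
  · rw [hz, norm_smul, hx, norm_inv, Real.norm_eq_abs, abs_abs, mul_one, inv_inv, smul_smul,
      mul_inv_cancel₀ hpos.ne', one_smul]

lemma yu_sphere_lt_top (d : ℕ) :
    μH[(d : ℝ)] (Metric.sphere (0 : EuclideanSpace ℝ (Fin (d + 1))) 1) < ⊤ := by
  have hface : ∀ (i : Fin (d + 1)) (e : ℝ), (e = 1 ∨ e = -1) →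
      μH[(d : ℝ)] ((fun v : Fin d → ℝ => (‖(WithLp.toLp 2 (i.insertNth (α := fun _ => ℝ) e v) : EuclideanSpace ℝ (Fin (d + 1)))‖⁻¹ •
        (WithLp.toLp 2 (i.insertNth (α := fun _ => ℝ) e v) : EuclideanSpace ℝ (Fin (d + 1))))) '' Set.Icc (-1) 1) < ⊤ := by
    intro i e he
    obtain ⟨K, hK⟩ := yu_face_lip d i e
    have hmaps : Set.MapsTo (fun v : Fin d → ℝ => (WithLp.toLp 2 (i.insertNth (α := fun _ => ℝ) e v) : EuclideanSpace ℝ (Fin (d + 1))))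
        (Set.Icc (-1) 1) {x | 1 ≤ ‖x‖} := by
      intro v _
      simp only [Set.mem_ofPred_eq]
      have := PiLp.norm_apply_le (WithLp.toLp 2 (i.insertNth (α := fun _ => ℝ) e v) : EuclideanSpace ℝ (Fin (d + 1))) i
      refine le_trans ?_ this
      rcases he with rfl | rfl <;> simp
    have hL := (yu_normalize_lip (E := EuclideanSpace ℝ (Fin (d + 1)))).comp (hK.lipschitzOnWith (s := Set.Icc (-1) 1)) hmaps
    refine lt_of_le_of_lt (hL.hausdorffMeasure_image_le (Nat.cast_nonneg d)) ?_
    have hv : (μH[(d : ℝ)] : Measure (Fin d → ℝ)) = volume := by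
      have := hausdorffMeasure_pi_real (ι := Fin d)
      simpa using this
    rw [hv]
    refine ENNReal.mul_lt_top ?_ ?_
    · exact ENNReal.rpow_lt_top_of_nonneg (Nat.cast_nonneg d) ENNReal.coe_ne_top
    · exact isCompact_Icc.measure_lt_top
  have hsub : Metric.sphere (0 : EuclideanSpace ℝ (Fin (d + 1))) 1 ⊆
      ⋃ i : Fin (d + 1), ((fun v : Fin d → ℝ => (‖(WithLp.toLp 2 (i.insertNth (α := fun _ => ℝ) (1:ℝ) v) : EuclideanSpace ℝ (Fin (d + 1)))‖⁻¹ •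
        (WithLp.toLp 2 (i.insertNth (α := fun _ => ℝ) (1:ℝ) v) : EuclideanSpace ℝ (Fin (d + 1))))) '' Set.Icc (-1) 1) ∪
       ((fun v : Fin d → ℝ => (‖(WithLp.toLp 2 (i.insertNth (α := fun _ => ℝ) (-1:ℝ) v) : EuclideanSpace ℝ (Fin (d + 1)))‖⁻¹ •
        (WithLp.toLp 2 (i.insertNth (α := fun _ => ℝ) (-1:ℝ) v) : EuclideanSpace ℝ (Fin (d + 1))))) '' Set.Icc (-1) 1) := by
    intro x hx
    obtain ⟨i, e, v, he, hv, h⟩ := yu_sphere_cover d x (by simpa using hx)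
    refine Set.mem_iUnion.2 ⟨i, ?_⟩
    rcases he with rfl | rfl
    · exact Or.inl ⟨v, hv, h⟩
    · exact Or.inr ⟨v, hv, h⟩
  refine lt_of_le_of_lt (measure_mono hsub) ?_
  refine lt_of_le_of_lt (measure_iUnion_le _) ?_
  rw [tsum_fintype]
  refine ENNReal.sum_lt_top.2 fun i _ => ?_
  exact lt_of_le_of_lt (measure_union_le _ _) (ENNReal.add_lt_top.2 ⟨hface i 1 (Or.inl rfl), hface i (-1) (Or.inr rfl)⟩)

lemma yu_sphere_pos (d : ℕ) :
    0 < μH[(d : ℝ)] (Metric.sphere (0 : EuclideanSpace ℝ (Fin (d + 1))) 1) := by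
  have hlip : LipschitzWith 1 (fun x : EuclideanSpace ℝ (Fin (d + 1)) => fun i : Fin d => x i.succ) := by
    refine LipschitzWith.of_dist_le_mul fun v w => ?_
    rw [NNReal.coe_one, one_mul]
    refine (dist_pi_le_iff dist_nonneg).2 fun j => ?_
    have := PiLp.norm_apply_le (v - w) j.succ
    rw [dist_eq_norm, dist_eq_norm]; simpa using this
  have h1 := hlip.hausdorffMeasure_image_le (Nat.cast_nonneg d : (0:ℝ) ≤ d) (Metric.sphere (0 : EuclideanSpace ℝ (Fin (d + 1))) 1)
  have hv : (μH[(d : ℝ)] : Measure (Fin d → ℝ)) = volume := by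
    have := hausdorffMeasure_pi_real (ι := Fin d)
    simpa using this
  rw [hv] at h1
  simp only [ENNReal.coe_one, ENNReal.one_rpow, one_mul] at h1
  refine lt_of_lt_of_le ?_ h1
  have hopen : IsOpen {v : Fin d → ℝ | ∑ i, v i ^ 2 < 1} :=
    isOpen_lt (by fun_prop) continuous_const
  have hpos : 0 < volume {v : Fin d → ℝ | ∑ i, v i ^ 2 < 1} :=
    hopen.measure_pos volume ⟨0, by simp⟩
  refine lt_of_lt_of_le hpos (measure_mono ?_)
  intro v hv
  simp only [Set.mem_ofPred_eq] at hv
  refine ⟨WithLp.toLp 2 (Fin.cons (√(1 - ∑ i, v i ^ 2)) v), ?_, ?_⟩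
  · rw [mem_sphere_zero_iff_norm, EuclideanSpace.norm_eq, Fin.sum_univ_succ]
    simp only [Fin.cons_zero, Fin.cons_succ, Real.norm_eq_abs, sq_abs]
    rw [Real.sq_sqrt (by linarith)]
    simp
  · ext i; simp

lemma yu_isProb (d : ℕ) : IsProbabilityMeasure (sphereMeasure d) := by
  constructor
  rw [sphereMeasure, Measure.smul_apply, Measure.restrict_apply MeasurableSet.univ, Set.univ_inter,
    smul_eq_mul]
  exact ENNReal.inv_mul_cancel (yu_sphere_pos d).ne' (yu_sphere_lt_top d).ne

lemma yu_ae_norm (d : ℕ) : ∀ᵐ y ∂(sphereMeasure d), ‖y‖ = 1 := by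
  rw [sphereMeasure]
  refine Measure.ae_smul_measure ?_ _
  filter_upwards [ae_restrict_mem (Metric.isClosed_sphere.measurableSet)] with y hy
  simpa using hy

lemma yu_inv (d : ℕ) (A : EuclideanSpace ℝ (Fin (d + 1)) ≃ₗᵢ[ℝ] EuclideanSpace ℝ (Fin (d + 1))) :
    (sphereMeasure d).map A = sphereMeasure d := by
  have h1 := (A.toIsometryEquiv.measurePreserving_hausdorffMeasure (d : ℝ)).restrict_preimage
    (s := Metric.sphere (0 : EuclideanSpace ℝ (Fin (d + 1))) 1) Metric.isClosed_sphere.measurableSet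
  have h2 : A.toIsometryEquiv ⁻¹' (Metric.sphere (0 : EuclideanSpace ℝ (Fin (d + 1))) 1) =
      Metric.sphere (0 : EuclideanSpace ℝ (Fin (d + 1))) 1 := by
    ext x; simp
  rw [h2] at h1
  have h3 := h1.map_eq
  rw [sphereMeasure, Measure.map_smul]
  congr 1

end SphereMeas

section OneDim

open Polynomial

/-- the weight -/
noncomputable def yuw (d : ℕ) (s : ℝ) : ℝ := (1 - s ^ 2) ^ ((d : ℝ) / 2 - 1)

/-- Legendre polynomials as polynomials -/
noncomputable def yuP (d : ℕ) : ℕ → ℝ[X]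
  | 0 => 1
  | 1 => X
  | n + 2 => C (((n : ℝ) + d)⁻¹) * (C (2 * (n : ℝ) + d + 1) * X * yuP d (n + 1)
      - C ((n : ℝ) + 1) * yuP d n)

lemma yuP_eval (d : ℕ) : ∀ (n : ℕ) (x : ℝ), legendreP d n x = (yuP d n).eval x
  | 0, x => by simp [legendreP, yuP]
  | 1, x => by simp [legendreP, yuP]
  | n + 2, x => by
      simp only [legendreP, yuP, yuP_eval d (n+1) x, yuP_eval d n x, eval_mul, eval_C, eval_sub, eval_X]
      rw [div_eq_inv_mul]

lemma yuP_rec (d : ℕ) (hd : 1 ≤ d) (n : ℕ) : ((n : ℝ[X]) + (d : ℝ[X])) * yuP d (n + 2) =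
    (2 * (n : ℝ[X]) + (d : ℝ[X]) + 1) * X * yuP d (n + 1) - ((n : ℝ[X]) + 1) * yuP d n := by
  have hne : ((n : ℝ) + d) ≠ 0 := by positivity
  have h1 : ((n : ℝ[X]) + (d : ℝ[X])) = C ((n : ℝ) + d) := by simp
  have h2 : (2 * (n : ℝ[X]) + (d : ℝ[X]) + 1) = C (2 * (n : ℝ) + d + 1) := by
    have hC2 : (C 2 : ℝ[X]) = 2 := map_ofNat C 2
    simp [hC2]
  have h3 : ((n : ℝ[X]) + 1) = C ((n : ℝ) + 1) := by simp
  rw [h1, h2, h3, yuP, ← mul_assoc, ← C_mul, mul_inv_cancel₀ hne, C_1, one_mul]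

lemma yuP_one (d : ℕ) (hd : 1 ≤ d) : ∀ n, (yuP d n).eval 1 = 1
  | 0 => by simp [yuP]
  | 1 => by simp [yuP]
  | n + 2 => by
      have hne : ((n : ℝ) + d) ≠ 0 := by positivity
      simp only [yuP, eval_mul, eval_C, eval_sub, eval_X, yuP_one d hd (n+1), yuP_one d hd n]
      field_simp; ring

lemma yuP_deg (d : ℕ) (hd : 1 ≤ d) : ∀ n, (yuP d n).natDegree ≤ n ∧ 0 < (yuP d n).coeff n
  | 0 => by simp [yuP]
  | 1 => by simp [yuP]
  | n + 2 => by
      obtain ⟨h1, h2⟩ := yuP_deg d hd (n+1)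
      obtain ⟨h3, h4⟩ := yuP_deg d hd n
      have hpos : 0 < ((n : ℝ) + d) := by positivity
      constructor
      · rw [yuP]
        refine (natDegree_C_mul_le _ _).trans ?_
        refine (natDegree_sub_le _ _).trans (max_le ?_ ?_)
        · rw [mul_assoc]
          refine (natDegree_C_mul_le _ _).trans ?_
          refine natDegree_mul_le.trans ?_
          have : (X : ℝ[X]).natDegree ≤ 1 := natDegree_X_le
          omega
        · refine (natDegree_C_mul_le _ _).trans (by omega)
      · rw [yuP, coeff_C_mul, coeff_sub, mul_assoc, coeff_C_mul, coeff_C_mul, coeff_X_mul,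
          coeff_eq_zero_of_natDegree_lt (p := yuP d n) (by omega)]
        have : 0 < (2 * (n : ℝ) + d + 1) := by positivity
        rw [mul_zero, sub_zero]
        positivity

lemma yuP_natDegree (d : ℕ) (hd : 1 ≤ d) (n : ℕ) : (yuP d n).natDegree = n :=
  natDegree_eq_of_le_of_coeff_ne_zero (yuP_deg d hd n).1 (yuP_deg d hd n).2.ne'

lemma yuP_ne_zero (d : ℕ) (hd : 1 ≤ d) (n : ℕ) : yuP d n ≠ 0 := by
  intro h
  have := (yuP_deg d hd n).2
  simp [h] at this

lemma yuP_AB (d : ℕ) (hd : 1 ≤ d) (n : ℕ) :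
    (1 - X ^ 2) * derivative (yuP d (n + 1)) = ((n : ℝ[X]) + 1) * (yuP d n - X * yuP d (n + 1)) ∧
    (1 - X ^ 2) * derivative (yuP d n) = ((n : ℝ[X]) + (d : ℝ[X]) - 1) * (X * yuP d n - yuP d (n + 1)) := by
  induction n with
  | zero => simp [yuP]; ring
  | succ n ih =>
    obtain ⟨hA, hB⟩ := ih
    have hr := yuP_rec d hd n
    have hne : ((n : ℝ[X]) + (d : ℝ[X])) ≠ 0 := by
      have : ((n : ℝ[X]) + (d : ℝ[X])) = C ((n : ℝ) + d) := by simp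
      rw [this, Ne, C_eq_zero]; positivity
    have hdr := congrArg derivative hr
    simp only [derivative_mul, derivative_add, derivative_sub, derivative_natCast, derivative_X,
      derivative_one, derivative_ofNat, zero_mul, mul_zero, add_zero, zero_add, mul_one] at hdr
    refine ⟨?_, ?_⟩
    · apply mul_left_cancel₀ hne
      push_cast
      linear_combination (1 - X^2) * hdr + (2 * (n : ℝ[X]) + (d : ℝ[X]) + 1) * X * hA - ((n : ℝ[X]) + 1) * hB
         + ((n : ℝ[X]) + 2) * X * hr
    · push_cast
      linear_combination hA + hr

lemma yuP_ode (d : ℕ) (hd : 1 ≤ d) (n : ℕ) :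
    (1 - X ^ 2) * derivative (derivative (yuP d n)) - (d : ℝ[X]) * X * derivative (yuP d n) =
      - ((n : ℝ[X]) * ((n : ℝ[X]) + (d : ℝ[X]) - 1)) * yuP d n := by
  cases n with
  | zero => simp [yuP]
  | succ n =>
    obtain ⟨hA, hB⟩ := yuP_AB d hd n
    have hne : (1 - X ^ 2 : ℝ[X]) ≠ 0 := by
      intro h
      have := congrArg (eval 0) h
      simp at this
    have hdA := congrArg derivative hA
    simp only [derivative_mul, derivative_add, derivative_sub, derivative_natCast, derivative_X, derivative_X_pow,
      derivative_one, derivative_ofNat, zero_mul, mul_zero, add_zero, zero_add, mul_one, one_mul, zero_sub] at hdA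
    have hC2 : (C 2 : ℝ[X]) = 2 := map_ofNat C 2
    simp [hC2] at hdA
    apply mul_left_cancel₀ hne
    push_cast
    linear_combination (1 - X^2) * hdA + (2 - (d : ℝ[X])) * X * hA + ((n : ℝ[X]) + 1) * hB - ((n : ℝ[X]) + 1) * X * hA

lemma yuP_deriv_pos (d : ℕ) (hd : 1 ≤ d) (x : ℝ) (hx : 1 ≤ x) (n : ℕ) :
    (1 ≤ (yuP d n).eval x ∧ (yuP d n).eval x ≤ (yuP d (n+1)).eval x) ∧
    (0 ≤ (derivative (yuP d n)).eval x ∧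
      (derivative (yuP d n)).eval x < (derivative (yuP d (n+1))).eval x) := by
  induction n with
  | zero => simp [yuP, hx]
  | succ n ih =>
    obtain ⟨⟨h1, h2⟩, h3, h4⟩ := ih
    have hr := yuP_rec d hd n
    have hdr := congrArg derivative hr
    simp only [derivative_mul, derivative_add, derivative_sub, derivative_natCast, derivative_X,
      derivative_one, derivative_ofNat, zero_mul, mul_zero, add_zero, zero_add, mul_one] at hdr
    have e1 := congrArg (eval x) hr
    have e2 := congrArg (eval x) hdr
    simp only [eval_mul, eval_add, eval_sub, eval_natCast, eval_one, eval_X, eval_ofNat] at e1 e2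
    have hpos : 0 < ((n : ℝ) + d) := by positivity
    have hc : 0 < 2 * (n : ℝ) + d + 1 := by positivity
    refine ⟨⟨h1.trans h2, ?_⟩, h3.trans h4.le, ?_⟩
    · refine le_of_mul_le_mul_left ?_ hpos
      have a1 : 0 ≤ (2 * (n : ℝ) + d + 1) * ((x - 1) * eval x (yuP d (n+1))) :=
        mul_nonneg hc.le (mul_nonneg (by linarith) (by linarith))
      have a2 : 0 ≤ ((n : ℝ) + 1) * (eval x (yuP d (n+1)) - eval x (yuP d n)) :=
        mul_nonneg (by positivity) (by linarith)
      rw [e1]; linarith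
    · refine lt_of_mul_lt_mul_left ?_ hpos.le
      have a1 : 0 ≤ (2 * (n : ℝ) + d + 1) * ((x - 1) * eval x (derivative (yuP d (n+1)))) :=
        mul_nonneg hc.le (mul_nonneg (by linarith) (by linarith))
      have a2 : 0 ≤ ((n : ℝ) + 1) * (eval x (derivative (yuP d (n+1))) - eval x (derivative (yuP d n))) :=
        mul_nonneg (by positivity) (by linarith)
      have a3 : 0 < (2 * (n : ℝ) + d + 1) * eval x (yuP d (n+1)) := mul_pos hc (by linarith)
      rw [e2]; linarith

lemma yuw_pos (d : ℕ) {s : ℝ} (h1 : -1 < s) (h2 : s < 1) : 0 < yuw d s :=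
  Real.rpow_pos_of_pos (by nlinarith) _

lemma yuw_nonneg (d : ℕ) {s : ℝ} (h1 : -1 ≤ s) (h2 : s ≤ 1) : 0 ≤ yuw d s :=
  Real.rpow_nonneg (by nlinarith) _

lemma yuw_meas (d : ℕ) : Measurable (yuw d) := by
  unfold yuw; fun_prop

lemma yuw_int (d : ℕ) (hd : 1 ≤ d) : IntervalIntegrable (yuw d) volume (-1) 1 := by
  rw [intervalIntegrable_iff_integrableOn_Ioo_of_le (by norm_num)]
  have h1 : IntegrableOn (fun s : ℝ => 1 / √(1 - s ^ 2)) (Set.Ioc (-1) 1) := by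
    refine intervalIntegral.integrableOn_deriv_of_nonneg Real.continuous_arcsin.continuousOn
      (fun x hx => ?_) (fun x hx => by positivity)
    exact Real.hasDerivAt_arcsin (by linarith [hx.1]) (by linarith [hx.2])
  refine Integrable.mono' (h1.mono_set Set.Ioo_subset_Ioc_self) (yuw_meas d).aestronglyMeasurable ?_
  filter_upwards [ae_restrict_mem measurableSet_Ioo] with s hs
  have hp : 0 < 1 - s ^ 2 := by nlinarith [hs.1, hs.2]
  rw [Real.norm_of_nonneg (yuw_nonneg d hs.1.le hs.2.le), one_div, Real.sqrt_eq_rpow, ← Real.rpow_neg hp.le]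
  refine Real.rpow_le_rpow_of_exponent_ge hp (by nlinarith) ?_
  have : (1 : ℝ) ≤ d := by exact_mod_cast hd
  linarith

lemma yuw_int_sub (d : ℕ) (hd : 1 ≤ d) {a b : ℝ} (ha : a ∈ Set.Icc (-1 : ℝ) 1) (hb : b ∈ Set.Icc (-1 : ℝ) 1) :
    IntervalIntegrable (yuw d) volume a b :=
  (yuw_int d hd).mono_set (Set.uIcc_subset_uIcc (by rwa [Set.uIcc_of_le (by norm_num)])
    (by rwa [Set.uIcc_of_le (by norm_num)]))

lemma yuw_mul_int (d : ℕ) (hd : 1 ≤ d) {a b : ℝ} (ha : a ∈ Set.Icc (-1 : ℝ) 1) (hb : b ∈ Set.Icc (-1 : ℝ) 1)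
    {f : ℝ → ℝ} (hf : Continuous f) :
    IntervalIntegrable (fun s => f s * yuw d s) volume a b :=
  (yuw_int_sub d hd ha hb).continuousOn_mul hf.continuousOn

lemma yu_ftc (d : ℕ) (hd : 1 ≤ d) (q : ℝ[X]) {a : ℝ} (ha : a ∈ Set.Icc (-1 : ℝ) 1) :
    ∫ s in a..1, ((1 - X ^ 2) * derivative q - (d : ℝ[X]) * X * q).eval s * yuw d s =
      - ((1 - a ^ 2) ^ ((d : ℝ) / 2) * q.eval a) := by
  have hd' : (0 : ℝ) < d := by exact_mod_cast hd
  have := intervalIntegral.integral_eq_sub_of_hasDerivAt_of_le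
    (f := fun s => (1 - s ^ 2) ^ ((d : ℝ) / 2) * q.eval s) ha.2
    (f' := fun s => ((1 - X ^ 2) * derivative q - (d : ℝ[X]) * X * q).eval s * yuw d s) ?_ ?_ ?_
  · rw [this]
    have h0 : (1 - (1:ℝ) ^ 2) ^ ((d : ℝ) / 2) = 0 := by
      rw [one_pow, sub_self, Real.zero_rpow (by positivity)]
    rw [h0]; ring
  · refine Continuous.continuousOn ?_
    refine Continuous.mul ?_ q.continuous
    exact Continuous.rpow_const (by fun_prop) (fun x => Or.inr (by positivity))
  · intro s hs
    have hs1 : -1 < s := lt_of_le_of_lt ha.1 hs.1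
    have hp : 0 < 1 - s ^ 2 := by nlinarith [hs.2]
    have h1 : HasDerivAt (fun s : ℝ => 1 - s ^ 2) (-(2 * s)) s := by
      simpa using ((hasDerivAt_id s).pow 2).const_sub 1
    have h2 := (h1.rpow_const (p := (d : ℝ) / 2) (Or.inl hp.ne')).mul (q.hasDerivAt s)
    convert! h2 using 1
    have h3 : (1 - s ^ 2) ^ ((d : ℝ) / 2) = (1 - s ^ 2) * yuw d s := by
      rw [yuw, Real.rpow_sub_one hp.ne']; field_simp
    rw [h3]
    simp only [eval_mul, eval_sub, eval_one, eval_pow, eval_X, eval_natCast, yuw]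
    ring
  · exact yuw_mul_int d hd ha (by norm_num) (Polynomial.continuous _)

/-- total mass -/
noncomputable def yuW (d : ℕ) : ℝ := ∫ s in (-1 : ℝ)..1, yuw d s

/-- expectation -/
noncomputable def yuE (d : ℕ) (f : ℝ → ℝ) : ℝ := (yuW d)⁻¹ * ∫ s in (-1 : ℝ)..1, f s * yuw d s

lemma yuW_pos (d : ℕ) (hd : 1 ≤ d) : 0 < yuW d :=
  intervalIntegral.intervalIntegral_pos_of_pos_on (yuw_int d hd) (fun _ hs => yuw_pos d hs.1 hs.2) (by norm_num)

lemma yuE_one (d : ℕ) (hd : 1 ≤ d) : yuE d (fun _ => 1) = 1 := by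
  simp only [yuE, one_mul]
  exact inv_mul_cancel₀ (yuW_pos d hd).ne'

lemma yuE_const_mul (d : ℕ) (c : ℝ) (f : ℝ → ℝ) : yuE d (fun s => c * f s) = c * yuE d f := by
  simp only [yuE, mul_assoc, intervalIntegral.integral_const_mul]; ring

lemma yuE_add (d : ℕ) (hd : 1 ≤ d) {f g : ℝ → ℝ} (hf : Continuous f) (hg : Continuous g) :
    yuE d (fun s => f s + g s) = yuE d f + yuE d g := by
  simp only [yuE, add_mul]
  rw [intervalIntegral.integral_add (yuw_mul_int d hd (by norm_num) (by norm_num) hf)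
    (yuw_mul_int d hd (by norm_num) (by norm_num) hg)]
  ring

lemma yuE_sub (d : ℕ) (hd : 1 ≤ d) {f g : ℝ → ℝ} (hf : Continuous f) (hg : Continuous g) :
    yuE d (fun s => f s - g s) = yuE d f - yuE d g := by
  simp only [yuE, sub_mul]
  rw [intervalIntegral.integral_sub (yuw_mul_int d hd (by norm_num) (by norm_num) hf)
    (yuw_mul_int d hd (by norm_num) (by norm_num) hg)]
  ring

lemma yuE_sum (d : ℕ) (hd : 1 ≤ d) {ι : Type*} (S : Finset ι) {f : ι → ℝ → ℝ} (hf : ∀ i ∈ S, Continuous (f i)) :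
    yuE d (fun s => ∑ i ∈ S, f i s) = ∑ i ∈ S, yuE d (f i) := by
  simp only [yuE, Finset.sum_mul]
  rw [intervalIntegral.integral_finsetSum (fun i hi => yuw_mul_int d hd (by norm_num) (by norm_num) (hf i hi)),
    Finset.mul_sum]

lemma yuE_mono (d : ℕ) (hd : 1 ≤ d) {f g : ℝ → ℝ} (hf : Continuous f) (hg : Continuous g)
    (h : ∀ s ∈ Set.Icc (-1 : ℝ) 1, f s ≤ g s) : yuE d f ≤ yuE d g := by
  unfold yuE
  refine mul_le_mul_of_nonneg_left ?_ (inv_nonneg.2 (yuW_pos d hd).le)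
  refine intervalIntegral.integral_mono_on (by norm_num) (yuw_mul_int d hd (by norm_num) (by norm_num) hf)
    (yuw_mul_int d hd (by norm_num) (by norm_num) hg) (fun s hs => ?_)
  exact mul_le_mul_of_nonneg_right (h s hs) (yuw_nonneg d hs.1 hs.2)

lemma yuE_pos (d : ℕ) (hd : 1 ≤ d) {f : ℝ → ℝ} (hf : Continuous f) (h : ∀ s ∈ Set.Icc (-1 : ℝ) 1, 0 ≤ f s)
    (s0 : ℝ) (hs0 : s0 ∈ Set.Ioo (-1 : ℝ) 1) (hpos : 0 < f s0) : 0 < yuE d f := by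
  refine mul_pos (inv_pos.2 (yuW_pos d hd)) ?_
  have hi := yuw_mul_int d hd (a := -1) (b := 1) (by norm_num) (by norm_num) hf
  rw [intervalIntegral.integral_pos_iff_support_of_nonneg_ae' ?_ hi]
  · refine ⟨by norm_num, ?_⟩
    have hopen : IsOpen ({s | 0 < f s} ∩ Set.Ioo (-1 : ℝ) 1) :=
      (isOpen_lt continuous_const hf).inter isOpen_Ioo
    refine lt_of_lt_of_le (hopen.measure_pos volume ⟨s0, hpos, hs0⟩) (measure_mono ?_)
    rintro s ⟨h1, h2⟩
    exact ⟨(mul_pos h1 (yuw_pos d h2.1 h2.2)).ne', h2.1, h2.2.le⟩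
  · rw [Set.uIoc_of_le (by norm_num)]
    filter_upwards [ae_restrict_mem measurableSet_Ioc] with s hs
    exact mul_nonneg (h s ⟨hs.1.le, hs.2⟩) (yuw_nonneg d hs.1.le hs.2)

lemma yuE_poly_eq_zero (d : ℕ) (hd : 1 ≤ d) (q : ℝ[X]) (h : ∀ s ∈ Set.Icc (-1 : ℝ) 1, 0 ≤ q.eval s)
    (h0 : yuE d (fun s => q.eval s) = 0) : q = 0 := by
  refine Polynomial.eq_zero_of_infinite_isRoot q ((Set.Ioo_infinite (show (-1:ℝ) < 1 by norm_num)).mono ?_)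
  intro s hs
  by_contra hne
  have : 0 < q.eval s := lt_of_le_of_ne (h s ⟨hs.1.le, hs.2.le⟩) (Ne.symm hne)
  exact (yuE_pos d hd q.continuous h s hs this).ne' h0

lemma yu_sl (d : ℕ) (hd : 1 ≤ d) (m n : ℕ) (c : ℝ) {a : ℝ} (ha : a ∈ Set.Icc (-1 : ℝ) 1)
    (hbd : (1 - a ^ 2) ^ ((d : ℝ) / 2) * ((yuP d m - C c) * derivative (yuP d n) -
       yuP d n * derivative (yuP d m)).eval a = 0) :
    ((m : ℝ) * (m + d - 1) - (n : ℝ) * (n + d - 1)) *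
       ∫ s in a..1, ((yuP d m - C c) * yuP d n).eval s * yuw d s =
      - ((m : ℝ) * (m + d - 1) * c) * ∫ s in a..1, (yuP d n).eval s * yuw d s := by
  have h1 := yu_ftc d hd ((yuP d m - C c) * derivative (yuP d n) -
       yuP d n * derivative (yuP d m)) ha
  rw [hbd, neg_zero] at h1
  have hom := yuP_ode d hd m
  have hon := yuP_ode d hd n
  have h2 : (1 - X ^ 2) * derivative ((yuP d m - C c) * derivative (yuP d n) -
       yuP d n * derivative (yuP d m)) - (d : ℝ[X]) * X * ((yuP d m - C c) * derivative (yuP d n) -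
       yuP d n * derivative (yuP d m)) = C ((m : ℝ) * (m + d - 1) - (n : ℝ) * (n + d - 1)) *
       ((yuP d m - C c) * yuP d n) + C ((m : ℝ) * (m + d - 1) * c) * yuP d n := by
    simp only [derivative_mul, derivative_sub, derivative_C, C_mul, C_sub, C_add, C_1, map_natCast]
    linear_combination (yuP d m - C c) * hon - yuP d n * hom
  rw [h2] at h1
  simp only [eval_add, eval_mul (p := C _), eval_C, add_mul, mul_assoc (G := ℝ) _ _ (yuw d _)] at h1
  rw [intervalIntegral.integral_add, intervalIntegral.integral_const_mul, intervalIntegral.integral_const_mul] at h1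
  · linarith
  · exact (yuw_mul_int d hd ha (by norm_num) (Polynomial.continuous _)).const_mul _
  · exact (yuw_mul_int d hd ha (by norm_num) (Polynomial.continuous _)).const_mul _

lemma yu_lam_lt (d : ℕ) (hd : 1 ≤ d) {m n : ℕ} (h : m < n) :
    (m : ℝ) * (m + d - 1) < (n : ℝ) * (n + d - 1) := by
  have h1 : (m : ℝ) + 1 ≤ n := by exact_mod_cast h
  have h2 : (1 : ℝ) ≤ d := by exact_mod_cast hd
  have h3 : (0 : ℝ) ≤ m := by positivity
  nlinarith

lemma yu_orth (d : ℕ) (hd : 1 ≤ d) {m n : ℕ} (h : m ≠ n) :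
    yuE d (fun s => (yuP d m * yuP d n).eval s) = 0 := by
  have hd' : (0 : ℝ) < d := by exact_mod_cast hd
  have h1 := yu_sl d hd m n 0 (a := -1) (by norm_num) (by
    rw [show (1 - (-1 : ℝ) ^ 2) = 0 by norm_num, Real.zero_rpow (by positivity), zero_mul])
  simp only [C_0, sub_zero, mul_zero, neg_zero, zero_mul, mul_eq_zero] at h1
  rcases h1 with h1 | h1
  · rcases lt_or_gt_of_ne h with h2 | h2
    · have := yu_lam_lt d hd h2; linarith
    · have := yu_lam_lt d hd h2; linarith
  · rw [yuE, h1, mul_zero]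

/-- polynomials of degree at most `n` are combinations of the Legendre polynomials -/
lemma yu_span (d : ℕ) (hd : 1 ≤ d) : ∀ (n : ℕ) (q : ℝ[X]), q.natDegree ≤ n →
    ∃ c : ℕ → ℝ, q = ∑ i ∈ Finset.range (n + 1), C (c i) * yuP d i := by
  intro n
  induction n with
  | zero =>
    intro q hq
    refine ⟨fun _ => q.coeff 0, ?_⟩
    simp [yuP]
    exact eq_C_of_natDegree_le_zero hq
  | succ n ih =>
    intro q hq
    set e := q.coeff (n+1) / (yuP d (n+1)).coeff (n+1) with he
    have hpos := (yuP_deg d hd (n+1)).2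
    have hr : (q - C e * yuP d (n+1)).natDegree ≤ n := by
      rw [natDegree_le_iff_coeff_eq_zero]
      intro N hN
      rw [coeff_sub, coeff_C_mul]
      rcases eq_or_lt_of_le (Nat.succ_le_of_lt hN) with h | h
      · rw [← h, he]; simp only [Nat.succ_eq_add_one]; field_simp; ring
      · rw [coeff_eq_zero_of_natDegree_lt (by omega),
          coeff_eq_zero_of_natDegree_lt (p := yuP d (n+1)) (by rw [yuP_natDegree d hd]; omega)]
        ring
    obtain ⟨c, hc⟩ := ih _ hr
    refine ⟨fun i => if i = n + 1 then e else c i, ?_⟩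
    rw [Finset.sum_range_succ]
    have : ∑ i ∈ Finset.range (n+1), C (if i = n + 1 then e else c i) * yuP d i
        = ∑ i ∈ Finset.range (n + 1), C (c i) * yuP d i := by
      refine Finset.sum_congr rfl fun i hi => ?_
      rw [if_neg (by have := Finset.mem_range.1 hi; omega)]
    rw [this, ← hc]
    simp

/-- if `f` is orthogonal to the first Legendre polynomials it is orthogonal to all polynomials
of small degree -/
lemma yu_orth_low (d : ℕ) (hd : 1 ≤ d) {f : ℝ → ℝ} (hf : Continuous f) (n : ℕ)
    (h : ∀ i ≤ n, yuE d (fun s => f s * (yuP d i).eval s) = 0) (q : ℝ[X]) (hq : q.natDegree ≤ n) :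
    yuE d (fun s => f s * q.eval s) = 0 := by
  obtain ⟨c, hc⟩ := yu_span d hd n q hq
  have : (fun s => f s * q.eval s) = fun s => ∑ i ∈ Finset.range (n+1), c i * (f s * (yuP d i).eval s) := by
    funext s
    rw [hc, eval_finsetSum, Finset.mul_sum]
    refine Finset.sum_congr rfl fun i _ => ?_
    simp only [eval_mul, eval_C]; ring
  rw [this, yuE_sum d hd (f := fun i s => c i * (f s * (yuP d i).eval s)) _ (fun i _ => by fun_prop)]
  refine Finset.sum_eq_zero fun i hi => ?_
  rw [yuE_const_mul, h i (by have := Finset.mem_range.1 hi; omega), mul_zero]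

lemma yuP_orth_low (d : ℕ) (hd : 1 ≤ d) (n : ℕ) (q : ℝ[X]) (hq : q.natDegree < n) :
    yuE d (fun s => (yuP d n).eval s * q.eval s) = 0 := by
  refine yu_orth_low d hd (Polynomial.continuous _) (n - 1) (fun i hi => ?_) q (by omega)
  have := yu_orth d hd (m := n) (n := i) (by omega)
  simpa only [eval_mul] using this

/-- uniqueness -/
lemma yu_uniq (d : ℕ) (hd : 1 ≤ d) (n : ℕ) (q : ℝ[X]) (hq : q.natDegree ≤ n)
    (h : ∀ r : ℝ[X], r.natDegree < n → yuE d (fun s => q.eval s * r.eval s) = 0) (s : ℝ) :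
    q.eval s = q.eval 1 * (yuP d n).eval s := by
  obtain ⟨c, hc⟩ := yu_span d hd n q hq
  have key : q - C (c n) * yuP d n = 0 := by
    rcases Nat.eq_zero_or_pos n with rfl | hn
    · rw [hc]; simp
    set r := q - C (c n) * yuP d n with hr
    have hrdeg : r.natDegree < n := by
      have : r = ∑ i ∈ Finset.range n, C (c i) * yuP d i := by
        rw [hr, hc, Finset.sum_range_succ]; simp
      rw [this]
      refine lt_of_le_of_lt (natDegree_sum_le_of_forall_le (n := n - 1) _ _ fun i hi => ?_) (by omega)
      have := Finset.mem_range.1 hi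
      refine (natDegree_C_mul_le _ _).trans ?_
      rw [yuP_natDegree d hd]; omega
    have h1 := h r hrdeg
    have h2 := yuP_orth_low d hd n r hrdeg
    have h3 : yuE d (fun s => (r * r).eval s) = 0 := by
      have : (fun s => (r * r).eval s) = fun s => q.eval s * r.eval s - c n * ((yuP d n).eval s * r.eval s) := by
        funext s
        conv_lhs => rw [eval_mul]
        nth_rewrite 1 [hr]
        simp only [eval_sub, eval_mul, eval_C]; ring
      rw [this, yuE_sub d hd (by fun_prop) (by fun_prop), h1, yuE_const_mul, h2]; simp
    have h4 := yuE_poly_eq_zero d hd (r * r) (fun s _ => by rw [eval_mul]; exact mul_self_nonneg _) h3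
    exact mul_self_eq_zero.1 h4
  have hq' : q = C (c n) * yuP d n := sub_eq_zero.1 key
  rw [hq']
  simp [yuP_one d hd]

/-- moments -/
lemma yuE_moment (d : ℕ) (hd : 1 ≤ d) (k : ℕ) :
    ((k : ℝ) + 1) * (yuE d (fun s => s ^ k) - yuE d (fun s => s ^ (k + 2))) = d * yuE d (fun s => s ^ (k + 2)) := by
  have hd' : (0 : ℝ) < d := by exact_mod_cast hd
  have h1 := yu_ftc d hd (X ^ (k + 1)) (a := -1) (by norm_num)
  rw [show (1 - (-1 : ℝ) ^ 2) = 0 by norm_num, Real.zero_rpow (by positivity), zero_mul, neg_zero] at h1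
  have h2 : yuE d (fun s => ((1 - X ^ 2) * derivative (X ^ (k+1)) - (d : ℝ[X]) * X * X ^ (k+1)).eval s) = 0 := by
    rw [yuE, h1, mul_zero]
  have h3 : (fun s : ℝ => ((1 - X ^ 2) * derivative (X ^ (k+1)) - (d : ℝ[X]) * X * X ^ (k+1)).eval s) =
      fun s => ((k : ℝ) + 1) * (s ^ k - s ^ (k+2)) - d * s ^ (k + 2) := by
    funext s
    simp [derivative_X_pow]; ring
  rw [h3, yuE_sub d hd (by fun_prop) (by fun_prop), yuE_const_mul, yuE_const_mul,
    yuE_sub d hd (by fun_prop) (by fun_prop)] at h2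
  linarith

lemma yuE_moment_one (d : ℕ) (hd : 1 ≤ d) : yuE d (fun s => s ^ 1) = 0 := by
  have := yu_orth d hd (m := 1) (n := 0) (by norm_num)
  simpa [yuP] using this

end OneDim

section SphereInt

open Polynomial

lemma yu_pair {E : Type*} [NormedAddCommGroup E] [InnerProductSpace ℝ E] (x x' u u' : E)
    (hx : ‖x‖ = 1) (hx' : ‖x'‖ = 1) (hu : ‖u‖ = 1) (hu' : ‖u'‖ = 1)
    (h : inner ℝ x x' = inner ℝ u u') : ∃ A : E ≃ₗᵢ[ℝ] E, A x = u ∧ A x' = u' := by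
  let A1 : E ≃ₗᵢ[ℝ] E := (ℝ ∙ (x - u))ᗮ.reflection
  have h1 : A1 x = u := Submodule.reflection_sub (hx.trans hu.symm)
  let A2 : E ≃ₗᵢ[ℝ] E := (ℝ ∙ (A1 x' - u'))ᗮ.reflection
  have h2 : A2 (A1 x') = u' := Submodule.reflection_sub (by rw [A1.norm_map, hx', hu'])
  have h3 : A2 u = u := by
    refine Submodule.reflection_mem_subspace_eq_self ?_
    rw [Submodule.mem_orthogonal_singleton_iff_inner_left, inner_sub_right]
    nth_rewrite 1 [← h1]
    rw [A1.inner_map_map, h, sub_self]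
  exact ⟨A1.trans A2, by simp [h1, h3], by simp [h2]⟩

variable {d : ℕ}

lemma yu_int_pair (F : ℝ → ℝ → ℝ) (x x' u u' : EuclideanSpace ℝ (Fin (d + 1)))
    (hx : ‖x‖ = 1) (hx' : ‖x'‖ = 1) (hu : ‖u‖ = 1) (hu' : ‖u'‖ = 1)
    (h : inner ℝ x x' = inner ℝ u u') :
    ∫ y, F (inner ℝ x y) (inner ℝ x' y) ∂(sphereMeasure d) =
      ∫ y, F (inner ℝ u y) (inner ℝ u' y) ∂(sphereMeasure d) := by
  obtain ⟨A, h1, h2⟩ := yu_pair x x' u u' hx hx' hu hu' h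
  conv_rhs => rw [← yu_inv d A]
  have := MeasureTheory.integral_map_equiv (μ := sphereMeasure d) A.toHomeomorph.toMeasurableEquiv
    (fun y => F (inner ℝ u y) (inner ℝ u' y))
  have h3 : (A.toHomeomorph.toMeasurableEquiv : EuclideanSpace ℝ (Fin (d + 1)) → EuclideanSpace ℝ (Fin (d + 1))) = A := rfl
  rw [h3] at this
  rw [this]
  simp only [← h1, ← h2, A.inner_map_map]

lemma yu_int_single (F : ℝ → ℝ) (x u : EuclideanSpace ℝ (Fin (d + 1)))
    (hx : ‖x‖ = 1) (hu : ‖u‖ = 1) :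
    ∫ y, F (inner ℝ x y) ∂(sphereMeasure d) = ∫ y, F (inner ℝ u y) ∂(sphereMeasure d) :=
  yu_int_pair (fun a _ => F a) x x u u hx hx hu hu (by
    rw [real_inner_self_eq_norm_sq, real_inner_self_eq_norm_sq, hx, hu])

lemma yu_inner_mem {x y : EuclideanSpace ℝ (Fin (d + 1))} (hx : ‖x‖ = 1) (hy : ‖y‖ = 1) :
    inner ℝ x y ∈ Set.Icc (-1 : ℝ) 1 := by
  have := abs_real_inner_le_norm x y
  rw [hx, hy, one_mul] at this
  exact abs_le.1 this

lemma yu_integrable {f : EuclideanSpace ℝ (Fin (d + 1)) → ℝ} (hf : Measurable f)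
    (C : ℝ) (hC : ∀ y, ‖y‖ = 1 → |f y| ≤ C) : Integrable f (sphereMeasure d) := by
  have := yu_isProb d
  refine Integrable.mono' (integrable_const C) hf.aestronglyMeasurable ?_
  filter_upwards [yu_ae_norm d] with y hy
  exact hC y hy

lemma yu_integrable_cont {f : EuclideanSpace ℝ (Fin (d + 1)) → ℝ} (hf : Continuous f) :
    Integrable f (sphereMeasure d) := by
  obtain ⟨C, hC⟩ := (isCompact_sphere (0 : EuclideanSpace ℝ (Fin (d + 1))) 1).exists_bound_of_continuousOn
    hf.continuousOn
  exact yu_integrable hf.measurable C (fun y hy => hC y (by simpa using hy))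

lemma yu_odd (F : ℝ → ℝ) (j : ℕ) (hj : Odd j) (u v : EuclideanSpace ℝ (Fin (d + 1)))
    (hu : ‖u‖ = 1) (hv : ‖v‖ = 1) (huv : inner ℝ u v = 0) :
    ∫ y, F (inner ℝ u y) * (inner ℝ v y) ^ j ∂(sphereMeasure d) = 0 := by
  have h := yu_int_pair (fun a b => F a * b ^ j) u v u (-v) hu hv hu (by simpa using hv)
    (by rw [inner_neg_right, huv, neg_zero])
  simp only [inner_neg_left, hj.neg_pow, mul_neg, integral_neg] at h
  linarith

lemma yu_mom2 (n : ℕ) (u v : EuclideanSpace ℝ (Fin (d + 1)))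
    (hu : ‖u‖ = 1) (hv : ‖v‖ = 1) (huv : inner ℝ u v = 0) :
    ((n : ℝ) + 1) * ∫ y, (inner ℝ u y) ^ n * (inner ℝ v y) ^ 2 ∂(sphereMeasure d) =
      ∫ y, (inner ℝ u y) ^ (n + 2) ∂(sphereMeasure d) := by
  have hvu : inner ℝ v u = 0 := by rw [real_inner_comm]; exact huv
  -- rotated identity
  have h0 : ∀ s : ℝ, ∫ y, (inner ℝ u y + s * inner ℝ v y) ^ (n + 1) *
      (inner ℝ v y - s * inner ℝ u y) ∂(sphereMeasure d) = 0 := by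
    intro s
    have hr : 0 < 1 + s ^ 2 := by positivity
    set r := √(1 + s ^ 2) with hrdef
    have hrpos : 0 < r := Real.sqrt_pos.2 hr
    have hr2 : r ^ 2 = 1 + s ^ 2 := Real.sq_sqrt hr.le
    have n1 : ‖r⁻¹ • (u + s • v)‖ = 1 := by
      rw [norm_smul, norm_inv, Real.norm_of_nonneg hrpos.le]
      have : ‖u + s • v‖ = r := by
        rw [← sq_eq_sq₀ (norm_nonneg _) hrpos.le, hr2, norm_add_sq_real, norm_smul, inner_smul_right, huv,
          hu, hv, Real.norm_eq_abs]
        simp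
      rw [this]; field_simp
    have n2 : ‖r⁻¹ • (v - s • u)‖ = 1 := by
      rw [norm_smul, norm_inv, Real.norm_of_nonneg hrpos.le]
      have : ‖v - s • u‖ = r := by
        rw [← sq_eq_sq₀ (norm_nonneg _) hrpos.le, hr2, norm_sub_sq_real, norm_smul, inner_smul_right, hvu,
          hu, hv, Real.norm_eq_abs]
        simp
      rw [this]; field_simp
    have n3 : inner ℝ (r⁻¹ • (u + s • v)) (r⁻¹ • (v - s • u)) = 0 := by
      simp only [inner_smul_left, inner_smul_right, inner_add_left, inner_sub_right, huv, hvu,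
        real_inner_self_eq_norm_sq, hu, hv]
      simp
      right; ring
    have := yu_odd (fun a => a ^ (n + 1)) 1 (by decide) _ _ n1 n2 n3
    simp only [inner_smul_left, inner_add_left, inner_sub_left, pow_one, mul_pow] at this
    have e : (fun y => (starRingEnd ℝ r⁻¹) ^ (n+1) * (inner ℝ u y + starRingEnd ℝ s * inner ℝ v y) ^ (n+1) *
        (starRingEnd ℝ r⁻¹ * (inner ℝ v y - starRingEnd ℝ s * inner ℝ u y))) =
        fun y : EuclideanSpace ℝ (Fin (d + 1)) => (r⁻¹ ^ (n + 2)) * ((inner ℝ u y + s * inner ℝ v y) ^ (n + 1) *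
      (inner ℝ v y - s * inner ℝ u y)) := by
      funext y
      simp only [conj_trivial]
      ring
    rw [e, integral_const_mul] at this
    exact (mul_eq_zero.1 this).resolve_left (by positivity)
  -- polynomial in s
  set M : ℕ → ℕ → ℝ := fun a b => ∫ y, (inner ℝ u y) ^ a * (inner ℝ v y) ^ b ∂(sphereMeasure d) with hM
  let Q : ℝ[X] := ∑ j ∈ Finset.range (n + 2),
    (C (((n+1).choose j : ℝ) * M (n + 1 - j) (j + 1)) * X ^ j - C (((n+1).choose j : ℝ) * M (n + 1 - j + 1) j) * X ^ (j + 1))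
  have hQ : Q = 0 := by
    refine Polynomial.funext fun s => ?_
    rw [eval_zero, ← h0 s]
    have e : (fun y : EuclideanSpace ℝ (Fin (d + 1)) => (inner ℝ u y + s * inner ℝ v y) ^ (n + 1) *
      (inner ℝ v y - s * inner ℝ u y)) = fun y => ∑ j ∈ Finset.range (n + 2),
        ((((n+1).choose j : ℝ) * s ^ j) * ((inner ℝ u y) ^ (n + 1 - j) * (inner ℝ v y) ^ (j + 1)) -
          (((n+1).choose j : ℝ) * s ^ (j + 1)) * ((inner ℝ u y) ^ (n + 1 - j + 1) * (inner ℝ v y) ^ j)) := by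
      funext y
      rw [add_comm, add_pow, Finset.sum_mul]
      refine Finset.sum_congr rfl fun j _ => ?_
      rw [mul_pow]; ring
    rw [e, integral_finsetSum _ (fun j _ => yu_integrable_cont (by fun_prop))]
    simp only [Q, eval_finsetSum]
    refine Finset.sum_congr rfl fun j _ => ?_
    rw [integral_sub (yu_integrable_cont (by fun_prop)) (yu_integrable_cont (by fun_prop)),
      integral_const_mul, integral_const_mul]
    simp only [eval_sub, eval_mul, eval_C, eval_pow, eval_X, hM]
    ring
  have hc : Q.coeff 1 = 0 := by rw [hQ, coeff_zero]
  simp only [Q, finsetSum_coeff, coeff_sub, coeff_C_mul, coeff_X_pow, Finset.sum_sub_distrib] at hc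
  rw [Finset.sum_eq_single 1, Finset.sum_eq_single 0] at hc
  · simp [hM] at hc
    linarith
  · intro j _ hj; rw [if_neg (by omega), mul_zero]
  · intro h; simp at h
  · intro j _ hj; rw [if_neg (by omega), mul_zero]
  · intro h; simp at h

/-- basis vectors -/
noncomputable def yue (d : ℕ) (i : Fin (d + 1)) : EuclideanSpace ℝ (Fin (d + 1)) := EuclideanSpace.single i 1

lemma yue_norm (i : Fin (d + 1)) : ‖yue d i‖ = 1 := by simp [yue]

lemma yue_inner (i : Fin (d + 1)) (y : EuclideanSpace ℝ (Fin (d + 1))) : inner ℝ (yue d i) y = y i := by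
  simp [yue, EuclideanSpace.inner_single_left]

lemma yue_ortho {i j : Fin (d + 1)} (h : i ≠ j) : inner ℝ (yue d i) (yue d j) = 0 := by
  rw [yue_inner]; simp [yue, h]

lemma yu_sph_moment (n : ℕ) :
    ((n : ℝ) + 1) * (∫ y, (inner ℝ (yue d 0) y) ^ n ∂(sphereMeasure d) -
        ∫ y, (inner ℝ (yue d 0) y) ^ (n + 2) ∂(sphereMeasure d)) =
      d * ∫ y, (inner ℝ (yue d 0) y) ^ (n + 2) ∂(sphereMeasure d) := by
  have h1 : ∫ y, (inner ℝ (yue d 0) y) ^ n ∂(sphereMeasure d) -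
        ∫ y, (inner ℝ (yue d 0) y) ^ (n + 2) ∂(sphereMeasure d) =
      ∑ i : Fin d, ∫ y, (inner ℝ (yue d 0) y) ^ n * (inner ℝ (yue d i.succ) y) ^ 2 ∂(sphereMeasure d) := by
    rw [← integral_sub (yu_integrable_cont (by fun_prop)) (yu_integrable_cont (by fun_prop)),
      ← integral_finsetSum _ (fun j _ => yu_integrable_cont (by fun_prop))]
    refine integral_congr_ae ?_
    filter_upwards [yu_ae_norm d] with y hy
    have h2 : ∑ i, (y i) ^ 2 = 1 := by
      have := EuclideanSpace.norm_sq_eq y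
      rw [hy] at this
      simpa using this.symm
    rw [Fin.sum_univ_succ] at h2
    simp only [yue_inner]
    rw [← Finset.mul_sum, ← sub_eq_iff_eq_add'.2 h2.symm]
    ring
  rw [h1, Finset.mul_sum]
  rw [Finset.sum_congr rfl (fun i _ => yu_mom2 n (yue d 0) (yue d i.succ) (yue_norm _) (yue_norm _)
    (yue_ortho (Fin.succ_ne_zero i).symm))]
  simp

lemma yu_moment_eq (hd : 1 ≤ d) : ∀ k : ℕ, ∫ y, (inner ℝ (yue d 0) y) ^ k ∂(sphereMeasure d) = yuE d (fun s => s ^ k)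
  | 0 => by
      have := yu_isProb d
      simp [yuE_one d hd]
  | 1 => by
      rw [yuE_moment_one d hd]
      have := yu_odd (d := d) (fun _ => 1) 1 (by decide) (yue d ⟨1, by omega⟩) (yue d 0) (yue_norm _) (yue_norm _)
        (yue_ortho (by simp [Fin.ext_iff]))
      simpa using this
  | k + 2 => by
      have h1 := yu_sph_moment (d := d) k
      have h2 := yuE_moment d hd k
      rw [yu_moment_eq hd k] at h1
      have h3 : ((k : ℝ) + 1 + d) ≠ 0 := by positivity
      apply mul_left_cancel₀ h3
      linarith

lemma yu_poly_eq (hd : 1 ≤ d) (q : ℝ[X]) :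
    ∫ y, q.eval (inner ℝ (yue d 0) y) ∂(sphereMeasure d) = yuE d (fun s => q.eval s) := by
  simp only [eval_eq_sum_range]
  rw [integral_finsetSum _ (fun j _ => yu_integrable_cont (by fun_prop)),
    yuE_sum d hd (f := fun i s => q.coeff i * s ^ i) _ (fun i _ => by fun_prop)]
  refine Finset.sum_congr rfl fun i _ => ?_
  rw [integral_const_mul, yu_moment_eq hd, yuE_const_mul]

lemma yu_cont_eq (hd : 1 ≤ d) (f : ℝ → ℝ) (hf : Continuous f) :
    ∫ y, f (inner ℝ (yue d 0) y) ∂(sphereMeasure d) = yuE d f := by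
  have := yu_isProb d
  refine eq_of_forall_dist_le fun ε hε => ?_
  obtain ⟨q, hq⟩ := exists_polynomial_near_of_continuousOn (-1) 1 f hf.continuousOn (ε / 2) (by linarith)
  have h1 : |∫ y, f (inner ℝ (yue d 0) y) ∂(sphereMeasure d) - ∫ y, q.eval (inner ℝ (yue d 0) y) ∂(sphereMeasure d)| ≤ ε / 2 := by
    rw [← integral_sub (yu_integrable_cont (by fun_prop)) (yu_integrable_cont (by fun_prop))]
    have := norm_integral_le_of_norm_le_const (μ := sphereMeasure d) (C := ε / 2)
      (f := fun y => f (inner ℝ (yue d 0) y) - q.eval (inner ℝ (yue d 0) y)) ?_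
    · simpa using this
    · filter_upwards [yu_ae_norm d] with y hy
      rw [Real.norm_eq_abs, abs_sub_comm]
      exact (hq _ (yu_inner_mem (yue_norm 0) hy)).le
  have h2 : |yuE d f - yuE d (fun s => q.eval s)| ≤ ε / 2 := by
    have e2 : yuE d (fun _ => ε / 2) = ε / 2 := by
      have := yuE_const_mul d (ε / 2) (fun _ => 1)
      rw [yuE_one d hd] at this
      simpa using this
    have a := yuE_mono d hd hf (g := fun s => q.eval s + ε / 2) (by fun_prop)
      (fun s hs => by have := abs_lt.1 (hq s hs); linarith [this.1])
    have b := yuE_mono d hd (f := fun s => q.eval s) (g := fun s => f s + ε / 2) (by fun_prop) (by fun_prop)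
      (fun s hs => by have := abs_lt.1 (hq s hs); linarith [this.2])
    rw [yuE_add d hd (by fun_prop) (by fun_prop), e2] at a b
    exact abs_le.2 ⟨by linarith, by linarith⟩
  rw [yu_poly_eq hd] at h1
  rw [Real.dist_eq]
  have := abs_le.1 h1
  have := abs_le.1 h2
  exact abs_le.2 ⟨by linarith, by linarith⟩

/-- the law of the first coordinate -/
lemma yu_law (hd : 1 ≤ d) (f : ℝ → ℝ) (hf : Measurable f) (x : EuclideanSpace ℝ (Fin (d + 1))) (hx : ‖x‖ = 1) :
    ∫ y, f (inner ℝ x y) ∂(sphereMeasure d) = yuE d f := by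
  have := yu_isProb d
  rw [yu_int_single f x (yue d 0) hx (yue_norm 0)]
  set ν := (sphereMeasure d).map (fun y => inner ℝ (yue d 0) y) with hν
  set ρ : Measure ℝ := (volume.restrict (Set.Ioc (-1 : ℝ) 1)).withDensity
    (fun s => ENNReal.ofReal ((yuW d)⁻¹ * yuw d s)) with hρ
  have hmi : Measurable (fun y : EuclideanSpace ℝ (Fin (d + 1)) => (inner ℝ (yue d 0) y : ℝ)) := by
    fun_prop
  have hρint : ∀ g : ℝ → ℝ, ∫ s, g s ∂ρ = yuE d g := by
    intro g
    rw [hρ, integral_withDensity_eq_integral_toReal_smul ((yuw_meas d).const_mul _).ennreal_ofReal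
      (Filter.Eventually.of_forall fun _ => ENNReal.ofReal_lt_top), yuE,
      intervalIntegral.integral_of_le (by norm_num), ← integral_const_mul]
    refine setIntegral_congr_fun measurableSet_Ioc fun s hs => ?_
    have := mul_nonneg (inv_nonneg.2 (yuW_pos d hd).le) (yuw_nonneg d hs.1.le hs.2)
    simp only [ENNReal.toReal_ofReal this, smul_eq_mul]
    ring
  have : IsFiniteMeasure ρ := by
    rw [hρ]
    refine isFiniteMeasure_withDensity_ofReal ?_
    have := (intervalIntegrable_iff_integrableOn_Ioc_of_le (by norm_num)).1 (yuw_int d hd)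
    exact (this.const_mul _).2
  have : IsProbabilityMeasure ν := Measure.isProbabilityMeasure_map hmi.aemeasurable
  have key : ν = ρ := by
    refine ext_of_forall_integral_eq_of_IsFiniteMeasure fun g => ?_
    rw [hρint, hν, integral_map hmi.aemeasurable g.continuous.aestronglyMeasurable]
    exact yu_cont_eq hd g g.continuous
  rw [← hρint, ← key, hν, integral_map hmi.aemeasurable hf.aestronglyMeasurable]

end SphereInt

section FunkHecke

open Polynomial

/-- measurable and bounded on `[-1, 1]` -/
def yuBM (g : ℝ → ℝ) : Prop := Measurable g ∧ ∃ B, ∀ s ∈ Set.Icc (-1 : ℝ) 1, |g s| ≤ B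

lemma yuBM_cont {g : ℝ → ℝ} (hg : Continuous g) : yuBM g := by
  refine ⟨hg.measurable, ?_⟩
  obtain ⟨C, hC⟩ := (isCompact_Icc (a := (-1 : ℝ)) (b := 1)).exists_bound_of_continuousOn hg.continuousOn
  exact ⟨C, hC⟩

lemma yuBM_mul {f g : ℝ → ℝ} (hf : yuBM f) (hg : yuBM g) : yuBM (fun s => f s * g s) := by
  obtain ⟨hf1, A, hA⟩ := hf
  obtain ⟨hg1, B, hB⟩ := hg
  refine ⟨hf1.mul hg1, A * B, fun s hs => ?_⟩
  rw [abs_mul]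
  exact mul_le_mul (hA s hs) (hB s hs) (abs_nonneg _) ((abs_nonneg _).trans (hA s hs))

variable {d : ℕ}

lemma yuBM_integrable {f g : ℝ → ℝ} (hf : yuBM f) (hg : yuBM g) {x x' : EuclideanSpace ℝ (Fin (d + 1))}
    (hx : ‖x‖ = 1) (hx' : ‖x'‖ = 1) :
    Integrable (fun y => f (inner ℝ x y) * g (inner ℝ x' y)) (sphereMeasure d) := by
  obtain ⟨hf1, A, hA⟩ := hf
  obtain ⟨hg1, B, hB⟩ := hg
  refine yu_integrable ?_ (A * B) (fun y hy => ?_)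
  · exact (hf1.comp (by fun_prop)).mul (hg1.comp (by fun_prop))
  · rw [abs_mul]
    exact mul_le_mul (hA _ (yu_inner_mem hx hy)) (hB _ (yu_inner_mem hx' hy)) (abs_nonneg _)
      ((abs_nonneg _).trans (hA _ (yu_inner_mem hx hy)))

lemma yu_conv_mono (hd : 1 ≤ d) (k : ℕ) (g : ℝ → ℝ) (hg : yuBM g) : ∃ Q : ℝ[X], Q.natDegree ≤ k ∧
    ∀ x x' : EuclideanSpace ℝ (Fin (d + 1)), ‖x‖ = 1 → ‖x'‖ = 1 →
      ∫ y, (inner ℝ x y) ^ k * g (inner ℝ x' y) ∂(sphereMeasure d) = Q.eval (inner ℝ x x') := by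
  set e0 := yue d 0 with he0
  set e1 := yue d ⟨1, by omega⟩ with he1
  have n0 : ‖e0‖ = 1 := yue_norm _
  have n1 : ‖e1‖ = 1 := yue_norm _
  have h01 : inner ℝ e0 e1 = 0 := yue_ortho (by simp [Fin.ext_iff])
  have h10 : inner ℝ e1 e0 = 0 := by rw [real_inner_comm]; exact h01
  let I : ℕ → ℝ := fun j => ∫ y, ((inner ℝ e0 y) ^ j * g (inner ℝ e0 y)) * (inner ℝ e1 y) ^ (k - j) ∂(sphereMeasure d)
  refine ⟨∑ j ∈ Finset.range (k + 1), if Even (k - j) then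
    C ((k.choose j : ℝ) * I j) * (X ^ j * (1 - X ^ 2) ^ ((k - j) / 2)) else 0, ?_, ?_⟩
  · refine natDegree_sum_le_of_forall_le _ _ fun j hj => ?_
    have hj' := Finset.mem_range.1 hj
    split_ifs with h
    · refine (natDegree_C_mul_le _ _).trans ?_
      refine natDegree_mul_le.trans ?_
      have a1 : (X ^ j : ℝ[X]).natDegree ≤ j := natDegree_X_pow_le j
      have a2 : (1 - X ^ 2 : ℝ[X]).natDegree ≤ 2 := by
        refine (natDegree_sub_le _ _).trans (max_le (by simp) (natDegree_X_pow_le 2))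
      have a3 : ((1 - X ^ 2 : ℝ[X]) ^ ((k - j) / 2)).natDegree ≤ (k - j) / 2 * 2 :=
        natDegree_pow_le_of_le _ a2
      omega
    · simp
  · intro x x' hx hx'
    have hmem := yu_inner_mem hx hx'
    set a := inner ℝ x x' with ha
    have hb0 : 0 ≤ 1 - a ^ 2 := by nlinarith [hmem.1, hmem.2]
    set b := √(1 - a ^ 2) with hb
    have hb2 : b ^ 2 = 1 - a ^ 2 := Real.sq_sqrt hb0
    have hu : ‖a • e0 + b • e1‖ = 1 := by
      rw [← sq_eq_sq₀ (norm_nonneg _) zero_le_one, norm_add_sq_real, norm_smul, norm_smul, inner_smul_left,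
        inner_smul_right, h01, n0, n1, Real.norm_eq_abs, Real.norm_eq_abs]
      simp [hb2]
    have hin : inner ℝ (a • e0 + b • e1) e0 = a := by
      rw [inner_add_left, inner_smul_left, inner_smul_left, h10, real_inner_self_eq_norm_sq, n0]; simp
    rw [yu_int_pair (fun p q => p ^ k * g q) x x' (a • e0 + b • e1) e0 hx hx' hu n0 (by rw [hin])]
    have e : (fun y => (inner ℝ (a • e0 + b • e1) y) ^ k * g (inner ℝ e0 y)) =
        fun y => ∑ j ∈ Finset.range (k + 1), ((k.choose j : ℝ) * a ^ j * b ^ (k - j)) *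
          (((inner ℝ e0 y) ^ j * g (inner ℝ e0 y)) * (inner ℝ e1 y) ^ (k - j)) := by
      funext y
      rw [inner_add_left, inner_smul_left, inner_smul_left, add_pow, Finset.sum_mul]
      refine Finset.sum_congr rfl fun j _ => ?_
      simp only [conj_trivial, mul_pow]; ring
    rw [e, integral_finsetSum _ (fun j _ => Integrable.const_mul
      (yuBM_integrable (yuBM_mul (yuBM_cont (g := fun s => s ^ j) (by fun_prop)) hg)
        (yuBM_cont (g := fun s => s ^ (k - j)) (by fun_prop)) n0 n1) _), eval_finsetSum]
    refine Finset.sum_congr rfl fun j _ => ?_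
    rw [integral_const_mul]
    split_ifs with h
    · obtain ⟨m, hm⟩ := h
      have hm2 : (k - j) / 2 = m := by omega
      have hbm : b ^ (k - j) = (1 - a ^ 2) ^ m := by rw [← hb2, ← pow_mul, hm]; congr 1; omega
      rw [hbm, hm2]
      simp only [eval_mul, eval_C, eval_pow, eval_X, eval_sub, eval_one, I]
      ring
    · rw [yu_odd (fun s => s ^ j * g s) (k - j) (Nat.not_even_iff_odd.1 h) e0 e1 n0 n1 h01]
      simp

lemma yu_conv_poly (hd : 1 ≤ d) (p : ℝ[X]) (g : ℝ → ℝ) (hg : yuBM g) : ∃ Q : ℝ[X], Q.natDegree ≤ p.natDegree ∧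
    ∀ x x' : EuclideanSpace ℝ (Fin (d + 1)), ‖x‖ = 1 → ‖x'‖ = 1 →
      ∫ y, p.eval (inner ℝ x y) * g (inner ℝ x' y) ∂(sphereMeasure d) = Q.eval (inner ℝ x x') := by
  choose Q hQ1 hQ2 using fun k => yu_conv_mono hd k g hg
  refine ⟨∑ k ∈ Finset.range (p.natDegree + 1), C (p.coeff k) * Q k, ?_, ?_⟩
  · refine natDegree_sum_le_of_forall_le _ _ fun j hj => ?_
    have hj' := Finset.mem_range.1 hj
    exact (natDegree_C_mul_le _ _).trans ((hQ1 j).trans (by omega))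
  · intro x x' hx hx'
    have e : (fun y => p.eval (inner ℝ x y) * g (inner ℝ x' y)) = fun y => ∑ k ∈ Finset.range (p.natDegree + 1),
        p.coeff k * ((inner ℝ x y) ^ k * g (inner ℝ x' y)) := by
      funext y
      rw [eval_eq_sum_range, Finset.sum_mul]
      exact Finset.sum_congr rfl fun j _ => by ring
    rw [e, integral_finsetSum _ (fun j _ => Integrable.const_mul
      (yuBM_integrable (yuBM_cont (g := fun s => s ^ j) (by fun_prop)) hg hx hx') _), eval_finsetSum]
    refine Finset.sum_congr rfl fun j _ => ?_
    rw [integral_const_mul, hQ2 j x x' hx hx', eval_mul, eval_C]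

lemma yu_fubini (hd : 1 ≤ d) {f1 f2 f3 Q R : ℝ → ℝ} (h1 : yuBM f1) (h2 : yuBM f2) (h3 : yuBM f3)
    (hQm : Measurable Q) (hRm : Measurable R)
    (hQ : ∀ x x' : EuclideanSpace ℝ (Fin (d + 1)), ‖x‖ = 1 → ‖x'‖ = 1 →
      ∫ y, f1 (inner ℝ x y) * f2 (inner ℝ x' y) ∂(sphereMeasure d) = Q (inner ℝ x x'))
    (hR : ∀ x x' : EuclideanSpace ℝ (Fin (d + 1)), ‖x‖ = 1 → ‖x'‖ = 1 →
      ∫ y, f1 (inner ℝ x y) * f3 (inner ℝ x' y) ∂(sphereMeasure d) = R (inner ℝ x x')) :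
    yuE d (fun s => Q s * f3 s) = yuE d (fun s => f2 s * R s) := by
  have := yu_isProb d
  set e := yue d 0 with he
  have ne : ‖e‖ = 1 := yue_norm _
  have hIntg : Integrable (Function.uncurry fun x y : EuclideanSpace ℝ (Fin (d + 1)) =>
      f1 (inner ℝ x y) * f2 (inner ℝ e y) * f3 (inner ℝ e x)) ((sphereMeasure d).prod (sphereMeasure d)) := by
    obtain ⟨m1, A, hA⟩ := h1
    obtain ⟨m2, B, hB⟩ := h2
    obtain ⟨m3, C, hC⟩ := h3
    refine Integrable.mono' (integrable_const (A * B * C)) ?_ ?_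
    · refine Measurable.aestronglyMeasurable ?_
      have hm1 : Measurable fun z : EuclideanSpace ℝ (Fin (d + 1)) × EuclideanSpace ℝ (Fin (d + 1)) =>
        (inner ℝ z.1 z.2 : ℝ) := by fun_prop
      have hm2 : Measurable fun z : EuclideanSpace ℝ (Fin (d + 1)) × EuclideanSpace ℝ (Fin (d + 1)) =>
        (inner ℝ e z.2 : ℝ) := by fun_prop
      have hm3 : Measurable fun z : EuclideanSpace ℝ (Fin (d + 1)) × EuclideanSpace ℝ (Fin (d + 1)) =>
        (inner ℝ e z.1 : ℝ) := by fun_prop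
      exact ((m1.comp hm1).mul (m2.comp hm2)).mul (m3.comp hm3)
    · have a1 := (Measure.quasiMeasurePreserving_fst (μ := sphereMeasure d) (ν := sphereMeasure d)).ae (yu_ae_norm d)
      have a2 := (Measure.quasiMeasurePreserving_snd (μ := sphereMeasure d) (ν := sphereMeasure d)).ae (yu_ae_norm d)
      filter_upwards [a1, a2] with z hz1 hz2
      simp only [Function.uncurry]
      rw [Real.norm_eq_abs, abs_mul, abs_mul]
      have b1 := hA _ (yu_inner_mem hz1 hz2)
      have b2 := hB _ (yu_inner_mem ne hz2)
      have b3 := hC _ (yu_inner_mem ne hz1)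
      have c1 := (abs_nonneg _).trans b1
      have c2 := (abs_nonneg _).trans b2
      gcongr
  rw [← yu_law hd (fun s => Q s * f3 s) (hQm.mul h3.1) e ne, ← yu_law hd (fun s => f2 s * R s) (h2.1.mul hRm) e ne]
  have s1 : ∫ x, Q (inner ℝ e x) * f3 (inner ℝ e x) ∂(sphereMeasure d) =
      ∫ x, ∫ y, f1 (inner ℝ x y) * f2 (inner ℝ e y) * f3 (inner ℝ e x) ∂(sphereMeasure d) ∂(sphereMeasure d) := by
    refine integral_congr_ae ?_
    filter_upwards [yu_ae_norm d] with x hx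
    rw [integral_mul_const, hQ x e hx ne, real_inner_comm]
  have s2 : ∫ y, f2 (inner ℝ e y) * R (inner ℝ e y) ∂(sphereMeasure d) =
      ∫ y, ∫ x, f1 (inner ℝ x y) * f2 (inner ℝ e y) * f3 (inner ℝ e x) ∂(sphereMeasure d) ∂(sphereMeasure d) := by
    refine integral_congr_ae ?_
    filter_upwards [yu_ae_norm d] with y hy
    have := hR y e hy ne
    rw [real_inner_comm, ← this, ← integral_const_mul]
    refine integral_congr_ae (Filter.Eventually.of_forall fun x => ?_)
    simp only [real_inner_comm x y]
    ring
  rw [s1, s2]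
  exact integral_integral_swap hIntg

lemma yu_conv_low (hd : 1 ≤ d) (l : ℕ) (r : ℝ[X]) (hr : r.natDegree < l)
    (x x' : EuclideanSpace ℝ (Fin (d + 1))) (hx : ‖x‖ = 1) (hx' : ‖x'‖ = 1) :
    ∫ y, r.eval (inner ℝ x y) * (yuP d l).eval (inner ℝ x' y) ∂(sphereMeasure d) = 0 := by
  have bP : yuBM (fun s => (yuP d l).eval s) := yuBM_cont (Polynomial.continuous _)
  obtain ⟨Q, hQ1, hQ2⟩ := yu_conv_poly hd r _ bP
  have bQ : yuBM (fun s => Q.eval s) := yuBM_cont (Polynomial.continuous _)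
  obtain ⟨R, hR1, hR2⟩ := yu_conv_poly hd r _ bQ
  have h := yu_fubini hd (yuBM_cont (g := fun s => r.eval s) (Polynomial.continuous _)) bP bQ
    (Q := fun s => Q.eval s) (R := fun s => R.eval s) (Polynomial.continuous _).measurable
    (Polynomial.continuous _).measurable hQ2 hR2
  rw [yuP_orth_low d hd l R (by omega)] at h
  have h4 := yuE_poly_eq_zero d hd (Q * Q) (fun s _ => by rw [eval_mul]; exact mul_self_nonneg _)
    (by simpa only [eval_mul] using h)
  have h5 : Q = 0 := mul_self_eq_zero.1 h4
  rw [hQ2 x x' hx hx', h5, eval_zero]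

lemma yu_funk_hecke (hd : 1 ≤ d) (l : ℕ) (g : ℝ → ℝ) (hg : yuBM g)
    (x x' : EuclideanSpace ℝ (Fin (d + 1))) (hx : ‖x‖ = 1) (hx' : ‖x'‖ = 1) :
    ∫ y, (yuP d l).eval (inner ℝ x y) * g (inner ℝ x' y) ∂(sphereMeasure d) =
      (yuP d l).eval (inner ℝ x x') * yuE d (fun s => (yuP d l).eval s * g s) := by
  have bP : yuBM (fun s => (yuP d l).eval s) := yuBM_cont (Polynomial.continuous _)
  obtain ⟨Q, hQ1, hQ2⟩ := yu_conv_poly hd (yuP d l) _ hg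
  rw [yuP_natDegree d hd] at hQ1
  have hu := yu_uniq d hd l Q hQ1 (fun r hr => by
    have h := yu_fubini hd bP hg (yuBM_cont (g := fun s => r.eval s) (Polynomial.continuous _))
      (Q := fun s => Q.eval s) (R := fun _ => 0) (Polynomial.continuous _).measurable
      measurable_const hQ2 (fun x x' hx hx' => by
        rw [← yu_conv_low hd l r hr x' x hx' hx]
        simp only [mul_comm])
    rw [h]; simp [yuE])
  rw [hQ2 x x' hx hx', hu]
  have h1 := hQ2 x' x' hx' hx'
  rw [real_inner_self_eq_norm_sq, hx', one_pow] at h1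
  rw [← h1, yu_law hd (fun s => (yuP d l).eval s * g s) ((Polynomial.continuous _).measurable.mul hg.1) x' hx']
  ring

end FunkHecke

section Final

open Polynomial

variable {d : ℕ}

lemma yu_card_pos {t : ℕ} {Y : Finset (EuclideanSpace ℝ (Fin (d + 1)))}
    (hdesign : IsSphericalDesign d t Y) : (0 : ℝ) < Y.card := by
  have := yu_isProb d
  have h := hdesign 1 (by simp)
  simp only [map_one, integral_const, probReal_univ, smul_eq_mul, mul_one, Finset.sum_const, nsmul_eq_mul] at h
  rcases Nat.eq_zero_or_pos Y.card with h0 | h0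
  · rw [h0] at h; simp at h
  · exact_mod_cast h0

lemma yu_design_sum (hd : 1 ≤ d) {t : ℕ} {Y : Finset (EuclideanSpace ℝ (Fin (d + 1)))}
    (hdesign : IsSphericalDesign d t Y) (l : ℕ) (hl : 1 ≤ l) (hlt : l ≤ t)
    (x : EuclideanSpace ℝ (Fin (d + 1))) (hx : ‖x‖ = 1) :
    ∑ y ∈ Y, (yuP d l).eval (inner ℝ x y) = 0 := by
  have hN := yu_card_pos hdesign
  let L : MvPolynomial (Fin (d + 1)) ℝ := ∑ i, MvPolynomial.C (x i) * MvPolynomial.X i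
  let p : MvPolynomial (Fin (d + 1)) ℝ := ∑ k ∈ Finset.range (l + 1), MvPolynomial.C ((yuP d l).coeff k) * L ^ k
  have hL : L.totalDegree ≤ 1 := by
    refine MvPolynomial.totalDegree_finsetSum_le fun i _ => ?_
    refine (MvPolynomial.totalDegree_mul _ _).trans ?_
    rw [MvPolynomial.totalDegree_C, MvPolynomial.totalDegree_X]
  have hp : p.totalDegree ≤ t := by
    refine MvPolynomial.totalDegree_finsetSum_le fun k hk => ?_
    have hk' := Finset.mem_range.1 hk
    refine (MvPolynomial.totalDegree_mul _ _).trans ?_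
    rw [MvPolynomial.totalDegree_C, zero_add]
    refine (MvPolynomial.totalDegree_pow _ _).trans ?_
    calc k * L.totalDegree ≤ k * 1 := Nat.mul_le_mul_left _ hL
      _ ≤ t := by omega
  have he : ∀ y : EuclideanSpace ℝ (Fin (d + 1)), MvPolynomial.eval (fun i => y i) p =
      (yuP d l).eval (inner ℝ x y) := by
    intro y
    have h1 : MvPolynomial.eval (fun i => y i) L = inner ℝ x y := by
      simp [L, PiLp.inner_apply, mul_comm]
    rw [eval_eq_sum_range, yuP_natDegree d hd]
    simp only [p, map_sum, map_mul, map_pow, h1, MvPolynomial.eval_C]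
  have h := hdesign p hp
  simp only [he] at h
  rw [yu_law hd (fun s => (yuP d l).eval s) (Polynomial.continuous _).measurable x hx] at h
  have h0 := yu_orth d hd (m := l) (n := 0) (by omega)
  simp only [yuP, mul_one] at h0
  rw [h0] at h
  rcases mul_eq_zero.1 h with h | h
  · exact absurd h (inv_ne_zero hN.ne')
  · exact h

lemma yu_kappa_pos (hd : 1 ≤ d) (l : ℕ) : 0 < yuE d (fun s => (yuP d l).eval s * (yuP d l).eval s) := by
  have h1 : 0 ≤ yuE d (fun s => (yuP d l).eval s * (yuP d l).eval s) := by
    have := yuE_mono d hd (f := fun _ => 0) (g := fun s => (yuP d l).eval s * (yuP d l).eval s)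
      continuous_const (by fun_prop) (fun s _ => mul_self_nonneg _)
    simpa [yuE] using this
  refine lt_of_le_of_ne h1 fun h => ?_
  have := yuE_poly_eq_zero d hd (yuP d l * yuP d l) (fun s _ => by rw [eval_mul]; exact mul_self_nonneg _)
    (by simp only [eval_mul]; exact h.symm)
  exact yuP_ne_zero d hd l (mul_self_eq_zero.1 this)

lemma yu_S_nonneg (hd : 1 ≤ d) (l : ℕ) (Y : Finset (EuclideanSpace ℝ (Fin (d + 1))))
    (hY : ∀ x ∈ Y, ‖x‖ = 1) :
    0 ≤ ∑ x ∈ Y, ∑ x' ∈ Y, (yuP d l).eval (inner ℝ x x') := by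
  have bP : yuBM (fun s => (yuP d l).eval s) := yuBM_cont (Polynomial.continuous _)
  have h : ∫ y, (∑ x ∈ Y, (yuP d l).eval (inner ℝ x y)) * (∑ x ∈ Y, (yuP d l).eval (inner ℝ x y)) ∂(sphereMeasure d)
      = (∑ x ∈ Y, ∑ x' ∈ Y, (yuP d l).eval (inner ℝ x x')) *
        yuE d (fun s => (yuP d l).eval s * (yuP d l).eval s) := by
    simp only [Finset.sum_mul_sum]
    rw [integral_finsetSum _ (fun x hx => integrable_finsetSum _ (fun x' hx' =>
      yuBM_integrable bP bP (hY x hx) (hY x' hx'))), Finset.sum_mul]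
    refine Finset.sum_congr rfl fun x hx => ?_
    rw [integral_finsetSum _ (fun x' hx' => yuBM_integrable bP bP (hY x hx) (hY x' hx')), Finset.sum_mul]
    exact Finset.sum_congr rfl fun x' hx' => yu_funk_hecke hd l _ bP x x' (hY x hx) (hY x' hx')
  have h0 : 0 ≤ ∫ y, (∑ x ∈ Y, (yuP d l).eval (inner ℝ x y)) * (∑ x ∈ Y, (yuP d l).eval (inner ℝ x y)) ∂(sphereMeasure d) :=
    integral_nonneg fun y => mul_self_nonneg _
  rw [h] at h0
  exact nonneg_of_mul_nonneg_left h0 (yu_kappa_pos hd l)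

lemma yu_approx (hd : 1 ≤ d) {h : ℝ → ℝ} (hh : Continuous h) {ε : ℝ} (hε : 0 < ε) : ∃ n : ℕ,
    yuE d (fun s => |h s - ∑ l ∈ Finset.range (n + 1), (yuE d (fun s => h s * (yuP d l).eval s) /
      yuE d (fun s => (yuP d l).eval s * (yuP d l).eval s)) * (yuP d l).eval s|) ≤ ε := by
  obtain ⟨q, hq⟩ := exists_polynomial_near_of_continuousOn (-1) 1 h hh.continuousOn ε hε
  refine ⟨q.natDegree, ?_⟩
  set n := q.natDegree with hn
  set a : ℕ → ℝ := fun l => (yuE d (fun s => h s * (yuP d l).eval s) /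
      yuE d (fun s => (yuP d l).eval s * (yuP d l).eval s)) with ha
  set Q : ℝ[X] := ∑ l ∈ Finset.range (n + 1), C (a l) * yuP d l with hQ
  have hQe : ∀ s, ∑ l ∈ Finset.range (n + 1), a l * (yuP d l).eval s = Q.eval s := by
    intro s; simp [hQ, eval_finsetSum]
  have hQd : Q.natDegree ≤ n := by
    refine natDegree_sum_le_of_forall_le _ _ fun j hj => ?_
    have hj' := Finset.mem_range.1 hj
    refine (natDegree_C_mul_le _ _).trans ?_
    rw [yuP_natDegree d hd]; omega
  have hc : Continuous fun s => h s - Q.eval s := hh.sub Q.continuous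
  have horth : ∀ r : ℝ[X], r.natDegree ≤ n → yuE d (fun s => (h s - Q.eval s) * r.eval s) = 0 := by
    refine fun r hr => yu_orth_low d hd hc n (fun i hi => ?_) r hr
    have e : (fun s => (h s - Q.eval s) * (yuP d i).eval s) = fun s => h s * (yuP d i).eval s -
        ∑ l ∈ Finset.range (n + 1), a l * ((yuP d l * yuP d i).eval s) := by
      funext s
      rw [← hQe, sub_mul, Finset.sum_mul]
      congr 1
      refine Finset.sum_congr rfl fun l _ => ?_
      rw [eval_mul]; ring
    rw [e, yuE_sub d hd (by fun_prop) (by fun_prop), yuE_sum d hd _ (fun l _ => by fun_prop)]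
    rw [Finset.sum_eq_single i]
    · rw [yuE_const_mul]
      simp only [eval_mul, ha]
      rw [div_mul_cancel₀ _ (yu_kappa_pos hd i).ne', sub_self]
    · intro l _ hl
      rw [yuE_const_mul, yu_orth d hd hl, mul_zero]
    · intro h; exact absurd (Finset.mem_range.2 (by omega)) h
  have h2 : yuE d (fun s => (h s - Q.eval s) ^ 2) ≤ ε ^ 2 := by
    have e : (fun s => (h s - q.eval s) ^ 2) = fun s => ((h s - Q.eval s) ^ 2 + 2 * ((h s - Q.eval s) * (Q - q).eval s))
        + ((Q - q).eval s) ^ 2 := by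
      funext s; rw [eval_sub]; ring
    have h3 : yuE d (fun s => (h s - q.eval s) ^ 2) ≤ yuE d (fun _ => ε ^ 2 * 1) := by
      refine yuE_mono d hd (by fun_prop) (by fun_prop) fun s hs => ?_
      have := hq s hs
      rw [abs_sub_comm] at this
      rw [mul_one, ← sq_abs]
      exact pow_le_pow_left₀ (abs_nonneg _) this.le 2
    rw [yuE_const_mul, yuE_one d hd, mul_one, e, yuE_add d hd (by fun_prop) (by fun_prop),
      yuE_add d hd (by fun_prop) (by fun_prop), yuE_const_mul, horth (Q - q)
        ((natDegree_sub_le _ _).trans (max_le hQd le_rfl))] at h3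
    have h4 : 0 ≤ yuE d (fun s => ((Q - q).eval s) ^ 2) := by
      have := yuE_mono d hd (f := fun _ => 0) (g := fun s => ((Q - q).eval s) ^ 2)
        continuous_const (by fun_prop) (fun s _ => sq_nonneg _)
      simpa [yuE] using this
    linarith
  change yuE d (fun s => |h s - ∑ l ∈ Finset.range (n + 1), a l * (yuP d l).eval s|) ≤ ε
  simp only [hQe]
  have h5 : yuE d (fun s => |h s - Q.eval s|) ≤ yuE d (fun s => (ε / 2) * 1 + (1 / (2 * ε)) * (h s - Q.eval s) ^ 2) := by
    refine yuE_mono d hd (by fun_prop) (by fun_prop) fun s hs => ?_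
    rw [← sq_abs (h s - Q.eval s)]
    set r := |h s - Q.eval s|
    have : (ε / 2) * 1 + (1 / (2 * ε)) * r ^ 2 - r = (1 / (2 * ε)) * (r - ε) ^ 2 := by
      field_simp; ring
    have h6 : 0 ≤ (1 / (2 * ε)) * (r - ε) ^ 2 := by positivity
    linarith
  rw [yuE_add d hd (by fun_prop) (by fun_prop), yuE_const_mul, yuE_const_mul, yuE_one d hd] at h5
  have h7 : (1 / (2 * ε)) * yuE d (fun s => (h s - Q.eval s) ^ 2) ≤ (1 / (2 * ε)) * ε ^ 2 :=
    mul_le_mul_of_nonneg_left h2 (by positivity)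
  have h8 : (1 / (2 * ε)) * ε ^ 2 = ε / 2 := by field_simp
  linarith

lemma yu_main (hd : 1 ≤ d) {t : ℕ} {Y : Finset (EuclideanSpace ℝ (Fin (d + 1)))}
    (hY : ∀ x ∈ Y, ‖x‖ = 1) (hdesign : IsSphericalDesign d t Y) {h χ : ℝ → ℝ} (hh : Continuous h)
    (hχ : yuBM χ) (hh0 : ∀ s, 0 ≤ h s) (hχ0 : ∀ s, 0 ≤ χ s) (hχ1 : ∀ s, χ s ≤ 1)
    (hhχ : ∀ s, h s * χ s = h s) (hpos : 0 < yuE d h)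
    (hsign : ∀ l, t < l → yuE d (fun s => h s * (yuP d l).eval s) * yuE d (fun s => (yuP d l).eval s * χ s) ≤ 0) :
    1 ≤ Y.card * yuE d χ := by
  have hN := yu_card_pos hdesign
  set N : ℝ := (Y.card : ℝ) with hNdef
  have bh := yuBM_cont hh
  have key : ∀ ε : ℝ, 0 < ε → N * yuE d h ≤ N ^ 2 * (yuE d h * yuE d χ) + ε := by
    intro ε' hε'
    obtain ⟨ε, hε, hεε⟩ : ∃ ε : ℝ, 0 < ε ∧ N ^ 2 * ε = ε' := ⟨ε' / N ^ 2, by positivity, by field_simp⟩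
    obtain ⟨n, hn⟩ := yu_approx hd hh hε
    set a : ℕ → ℝ := fun l => (yuE d (fun s => h s * (yuP d l).eval s) /
      yuE d (fun s => (yuP d l).eval s * (yuP d l).eval s)) with ha
    set b : ℕ → ℝ := fun l => yuE d (fun s => (yuP d l).eval s * χ s) with hb
    set q : ℝ → ℝ := fun s => ∑ l ∈ Finset.range (n + 1), a l * (yuP d l).eval s with hq
    change yuE d (fun s => |h s - q s|) ≤ ε at hn
    have hqc : Continuous q := by fun_prop
    have bq := yuBM_cont hqc
    have br : yuBM (fun s => |h s - q s|) := yuBM_cont (by fun_prop)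
    let F : EuclideanSpace ℝ (Fin (d + 1)) → EuclideanSpace ℝ (Fin (d + 1)) → ℝ := fun x x' =>
      ∫ y, h (inner ℝ x y) * χ (inner ℝ x' y) ∂(sphereMeasure d)
    have hF0 : ∀ x x', 0 ≤ F x x' := fun x x' => integral_nonneg fun y => mul_nonneg (hh0 _) (hχ0 _)
    have hF1 : ∀ x ∈ Y, F x x = yuE d h := by
      intro x hx
      simp only [F, hhχ]
      exact yu_law hd h hh.measurable x (hY x hx)
    have hF2 : ∀ x ∈ Y, ∀ x' ∈ Y, F x x' ≤
        ∑ l ∈ Finset.range (n + 1), a l * ((yuP d l).eval (inner ℝ x x') * b l) + ε := by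
      intro x hx x' hx'
      have i1 := yuBM_integrable bh hχ (hY x hx) (hY x' hx')
      have i2 := yuBM_integrable bq hχ (hY x hx) (hY x' hx')
      have i3 : Integrable (fun y => |h (inner ℝ x y) - q (inner ℝ x y)|) (sphereMeasure d) := by
        have := yuBM_integrable br (yuBM_cont (g := fun _ => 1) continuous_const) (hY x hx) (hY x' hx')
        simpa using this
      have e1 : F x x' ≤ ∫ y, (q (inner ℝ x y) * χ (inner ℝ x' y) + |h (inner ℝ x y) - q (inner ℝ x y)|) ∂(sphereMeasure d) := by
        refine integral_mono i1 (i2.add i3) fun y => ?_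
        have c1 := le_abs_self (h (inner ℝ x y) - q (inner ℝ x y))
        have c2 := abs_nonneg (h (inner ℝ x y) - q (inner ℝ x y))
        have c3 := hχ0 (inner ℝ x' y)
        have c4 := hχ1 (inner ℝ x' y)
        simp only
        nlinarith
      rw [integral_add i2 i3, yu_law hd (fun s => |h s - q s|) (by fun_prop) x (hY x hx)] at e1
      have e2 : ∫ y, q (inner ℝ x y) * χ (inner ℝ x' y) ∂(sphereMeasure d) =
          ∑ l ∈ Finset.range (n + 1), a l * ((yuP d l).eval (inner ℝ x x') * b l) := by
        have e3 : (fun y => q (inner ℝ x y) * χ (inner ℝ x' y)) = fun y => ∑ l ∈ Finset.range (n + 1),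
            a l * ((yuP d l).eval (inner ℝ x y) * χ (inner ℝ x' y)) := by
          funext y
          simp only [hq, Finset.sum_mul, mul_assoc]
        rw [e3, integral_finsetSum _ (fun l _ => Integrable.const_mul
          (yuBM_integrable (yuBM_cont (Polynomial.continuous (yuP d l))) hχ (hY x hx) (hY x' hx')) _)]
        refine Finset.sum_congr rfl fun l _ => ?_
        rw [integral_const_mul, yu_funk_hecke hd l χ hχ x x' (hY x hx) (hY x' hx')]
      rw [e2] at e1
      linarith
    have hlow : N * yuE d h ≤ ∑ x ∈ Y, ∑ x' ∈ Y, F x x' := by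
      rw [hNdef, ← nsmul_eq_mul, ← Finset.sum_const]
      refine Finset.sum_le_sum fun x hx => ?_
      rw [← hF1 x hx]
      exact Finset.single_le_sum (f := fun x' => F x x') (fun x' _ => hF0 x x') hx
    have hup : ∑ x ∈ Y, ∑ x' ∈ Y, F x x' ≤ ∑ x ∈ Y, ∑ x' ∈ Y,
        (∑ l ∈ Finset.range (n + 1), a l * ((yuP d l).eval (inner ℝ x x') * b l) + ε) :=
      Finset.sum_le_sum fun x hx => Finset.sum_le_sum fun x' hx' => hF2 x hx x' hx'
    have e4 : ∑ x ∈ Y, ∑ x' ∈ Y,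
        (∑ l ∈ Finset.range (n + 1), a l * ((yuP d l).eval (inner ℝ x x') * b l) + ε) =
        ∑ l ∈ Finset.range (n + 1), (a l * b l) * (∑ x ∈ Y, ∑ x' ∈ Y, (yuP d l).eval (inner ℝ x x')) + ε' := by
      simp only [Finset.sum_add_distrib, Finset.sum_const, nsmul_eq_mul, ← hNdef]
      congr 1
      · rw [Finset.sum_congr rfl fun x _ => Finset.sum_comm, Finset.sum_comm]
        refine Finset.sum_congr rfl fun l _ => ?_
        simp only [Finset.mul_sum]
        refine Finset.sum_congr rfl fun x _ => Finset.sum_congr rfl fun x' _ => ?_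
        ring
      · rw [← hεε]; ring
    have e5 : ∑ l ∈ Finset.range (n + 1), (a l * b l) * (∑ x ∈ Y, ∑ x' ∈ Y, (yuP d l).eval (inner ℝ x x')) ≤
        N ^ 2 * (yuE d h * yuE d χ) := by
      rw [Finset.sum_range_succ']
      have z : ∑ k ∈ Finset.range n, (a (k + 1) * b (k + 1)) *
          (∑ x ∈ Y, ∑ x' ∈ Y, (yuP d (k + 1)).eval (inner ℝ x x')) ≤ 0 := by
        refine Finset.sum_nonpos fun k _ => ?_
        rcases Nat.lt_or_ge t (k + 1) with hk | hk
        · refine mul_nonpos_of_nonpos_of_nonneg ?_ (yu_S_nonneg hd (k + 1) Y hY)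
          have := hsign (k + 1) hk
          simp only [ha, hb]
          rw [div_mul_eq_mul_div]
          exact div_nonpos_of_nonpos_of_nonneg this (yu_kappa_pos hd (k + 1)).le
        · rw [Finset.sum_eq_zero (s := Y) fun x hx =>
            yu_design_sum hd hdesign (k + 1) (by omega) hk x (hY x hx), mul_zero]
      have z0 : (a 0 * b 0) * (∑ x ∈ Y, ∑ x' ∈ Y, (yuP d 0).eval (inner ℝ x x')) = N ^ 2 * (yuE d h * yuE d χ) := by
        simp only [ha, hb, yuP, eval_one, mul_one, one_mul, yuE_one d hd, div_one, Finset.sum_const, nsmul_eq_mul,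
          ← hNdef]
        ring
      linarith
    linarith
  have k2 : N * yuE d h ≤ N ^ 2 * (yuE d h * yuE d χ) := le_of_forall_pos_le_add key
  have k3 : (N * yuE d h) * 1 ≤ (N * yuE d h) * (N * yuE d χ) := by linarith
  exact le_of_mul_le_mul_left k3 (by positivity)

end Final
section Specific

open Polynomial

variable {d : ℕ}

lemma yuE_chi (α : ℝ) (h1 : -1 < α) (h2 : α < 1) (f : ℝ → ℝ) :
    yuE d (fun s => f s * (Set.Ioi α).indicator (fun _ => (1 : ℝ)) s) =
      (yuW d)⁻¹ * ∫ s in α..1, f s * yuw d s := by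
  unfold yuE
  congr 1
  have e : (fun s => f s * (Set.Ioi α).indicator (fun _ => (1 : ℝ)) s * yuw d s) =
      (Set.Ioi α).indicator (fun s => f s * yuw d s) := by
    funext s
    by_cases hs : s ∈ Set.Ioi α <;> simp [hs]
  rw [e, intervalIntegral.integral_of_le (by norm_num), intervalIntegral.integral_of_le h2.le,
    setIntegral_indicator measurableSet_Ioi]
  congr 2
  ext s
  simp only [Set.mem_inter_iff, Set.mem_Ioc, Set.mem_Ioi]
  constructor
  · rintro ⟨⟨_, b⟩, c⟩; exact ⟨c, b⟩
  · rintro ⟨b, c⟩; exact ⟨⟨by linarith, c⟩, b⟩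

lemma yu_spec (hd : 1 ≤ d) (t : ℕ) (α : ℝ)
    (h0 : (derivative (yuP d (t + 1))).eval α = 0)
    (hmax : ∀ x : ℝ, (derivative (yuP d (t + 1))).eval x = 0 → x ≤ α)
    {Y : Finset (EuclideanSpace ℝ (Fin (d + 1)))}
    (hY : ∀ x ∈ Y, ‖x‖ = 1) (hdesign : IsSphericalDesign d t Y) :
    (-1 < α ∧ α < 1) ∧ 1 ≤ Y.card * ((yuW d)⁻¹ * ∫ s in α..1, yuw d s) := by
  have ht : 1 ≤ t := by
    rcases Nat.eq_zero_or_pos t with rfl | h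
    · simp [yuP] at h0
    · exact h
  set P := yuP d (t + 1) with hP
  have hP1 : ∀ x, 1 ≤ x → 0 < (derivative P).eval x := fun x hx =>
    ((yuP_deriv_pos d hd x hx t).2.1).trans_lt (yuP_deriv_pos d hd x hx t).2.2
  have hα1 : α < 1 := by
    by_contra h
    exact (hP1 α (not_lt.1 h)).ne' h0
  have hder : ∀ x, α < x → 0 < (derivative P).eval x := by
    intro x hx
    by_contra hneg
    have hneg := not_lt.1 hneg
    have hx1 : x ≤ 1 := by
      by_contra h
      exact absurd (hP1 x (not_le.1 h).le) (not_lt.2 hneg)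
    obtain ⟨z, hz, hz0⟩ := intermediate_value_Icc hx1 (f := fun s => (derivative P).eval s)
      (derivative P).continuous.continuousOn (show (0 : ℝ) ∈ Set.Icc _ _ from ⟨hneg, (hP1 1 le_rfl).le⟩)
    have := hmax z hz0
    linarith [hz.1]
  have hmono : StrictMonoOn (fun s => P.eval s) (Set.Ici α) := by
    refine strictMonoOn_of_deriv_pos (convex_Ici α) P.continuous.continuousOn fun x hx => ?_
    rw [interior_Ici] at hx
    rw [Polynomial.deriv]
    exact hder x hx
  have hα2 : -1 < α := by
    by_contra hneg
    have hneg := not_lt.1 hneg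
    have hR := yuE_poly_eq_zero d hd ((P - C (P.eval 0)) * X) (fun s hs => by
      have hs1 : s ∈ Set.Ici α := by simp only [Set.mem_Ici]; linarith [hs.1]
      have hs0 : (0 : ℝ) ∈ Set.Ici α := by simp only [Set.mem_Ici]; linarith
      simp only [eval_mul, eval_sub, eval_C, eval_X]
      rcases le_total 0 s with h | h
      · have := hmono.monotoneOn hs0 hs1 h
        exact mul_nonneg (by linarith) h
      · have := hmono.monotoneOn hs1 hs0 h
        exact mul_nonneg_of_nonpos_of_nonpos (by linarith) h) (by
      have e : (fun s => ((P - C (P.eval 0)) * X).eval s) = fun s => (yuP d (t + 1) * yuP d 1).eval s -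
          P.eval 0 * (yuP d 1 * yuP d 0).eval s := by
        funext s
        simp only [eval_mul, eval_sub, eval_C, eval_X, yuP, eval_one, hP]
        ring
      rw [e, yuE_sub d hd (by fun_prop) (by fun_prop), yuE_const_mul, yu_orth d hd (by omega),
        yu_orth d hd (by omega)]
      simp)
    rcases mul_eq_zero.1 hR with h | h
    · have hdeg := yuP_natDegree d hd (t + 1)
      rw [← hP, sub_eq_zero.1 h, natDegree_C] at hdeg
      omega
    · exact X_ne_zero h
  refine ⟨⟨hα2, hα1⟩, ?_⟩
  have hαm : α ∈ Set.Icc (-1 : ℝ) 1 := ⟨hα2.le, hα1.le⟩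
  set c := P.eval α with hc
  let h : ℝ → ℝ := fun s => P.eval (max s α) - c
  let χ : ℝ → ℝ := (Set.Ioi α).indicator (fun _ => (1 : ℝ))
  have hh : Continuous h := by
    have := P.continuous
    exact (this.comp (continuous_id.max continuous_const)).sub continuous_const
  have hχm : Measurable χ := measurable_const.indicator measurableSet_Ioi
  have hχ0 : ∀ s, 0 ≤ χ s := fun s => Set.indicator_nonneg (fun _ _ => zero_le_one) s
  have hχ1 : ∀ s, χ s ≤ 1 := fun s => Set.indicator_le_self' (fun _ _ => zero_le_one) s
  have hχ : yuBM χ := ⟨hχm, 1, fun s _ => by rw [abs_of_nonneg (hχ0 s)]; exact hχ1 s⟩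
  have hh0 : ∀ s, 0 ≤ h s := by
    intro s
    have := hmono.monotoneOn (Set.self_mem_Ici) (Set.mem_Ici.2 (le_max_right s α)) (le_max_right s α)
    simp only [h]; linarith
  have hhχ' : ∀ s, h s = (P - C c).eval s * χ s := by
    intro s
    by_cases hs : α < s
    · simp [h, χ, hs, max_eq_left hs.le]
    · simp [h, χ, hs, max_eq_right (not_lt.1 hs), hc]
  have hhχ : ∀ s, h s * χ s = h s := by
    intro s
    by_cases hs : α < s
    · simp [χ, hs]
    · rw [hhχ' s]; simp [χ, hs]
  have hpos : 0 < yuE d h := by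
    refine yuE_pos d hd hh (fun s _ => hh0 s) ((α + 1) / 2) ⟨by linarith, by linarith⟩ ?_
    have hlt : α < (α + 1) / 2 := by linarith
    have := hmono (Set.self_mem_Ici) (show (α + 1) / 2 ∈ Set.Ici α from hlt.le) hlt
    simp only at this
    simp only [h, max_eq_left hlt.le]
    linarith
  have hA : ∀ l, yuE d (fun s => h s * (yuP d l).eval s) =
      (yuW d)⁻¹ * ∫ s in α..1, ((P - C c) * yuP d l).eval s * yuw d s := by
    intro l
    rw [← yuE_chi α hα2 hα1]
    congr 1
    funext s
    rw [hhχ' s, eval_mul]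
    simp only [χ]; ring
  have hB : ∀ l, yuE d (fun s => (yuP d l).eval s * χ s) =
      (yuW d)⁻¹ * ∫ s in α..1, (yuP d l).eval s * yuw d s := fun l => yuE_chi α hα2 hα1 _
  have hχE : yuE d χ = (yuW d)⁻¹ * ∫ s in α..1, yuw d s := by
    have := hB 0
    simpa [yuP] using this
  have hWpos : 0 < ∫ s in α..1, yuw d s :=
    intervalIntegral.intervalIntegral_pos_of_pos_on (yuw_int_sub d hd hαm (by norm_num))
      (fun s hs => yuw_pos d (by linarith [hs.1]) hs.2) hα1
  have hχpos : 0 < yuE d χ := by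
    rw [hχE]; exact mul_pos (inv_pos.2 (yuW_pos d hd)) hWpos
  set lam : ℕ → ℝ := fun l => (l : ℝ) * (l + d - 1) with hlam
  have hsl : ∀ l, (lam (t + 1) - lam l) * yuE d (fun s => h s * (yuP d l).eval s) =
      -(lam (t + 1) * c) * yuE d (fun s => (yuP d l).eval s * χ s) := by
    intro l
    have := yu_sl d hd (t + 1) l c hαm (by
      simp only [eval_sub, eval_mul, eval_C, ← hP, ← hc, h0]
      ring)
    rw [hA, hB, mul_left_comm, hlam]
    simp only
    rw [this]; ring
  have hlpos : 0 < lam (t + 1) := by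
    have := yu_lam_lt d hd (m := 0) (n := t + 1) (by omega)
    simpa [hlam] using this
  have hcneg : 0 < -(lam (t + 1) * c) := by
    have h1 := hsl 0
    simp only [yuP, eval_one, mul_one, one_mul] at h1
    have hl0 : lam 0 = 0 := by simp [hlam]
    rw [hl0, sub_zero] at h1
    have h2 : 0 < -(lam (t + 1) * c) * yuE d χ := by
      have h3 : yuE d (fun s => χ s) = yuE d χ := rfl
      rw [← h3, ← h1]; exact mul_pos hlpos hpos
    exact pos_of_mul_pos_left h2 hχpos.le
  rw [← hχE]
  refine yu_main hd hY hdesign hh hχ hh0 hχ0 hχ1 hhχ hpos fun l hl => ?_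
  have h1 := hsl l
  rcases Nat.lt_or_ge (t + 1) l with hl2 | hl2
  · have h2 : lam (t + 1) < lam l := yu_lam_lt d hd hl2
    set A := yuE d (fun s => h s * (yuP d l).eval s)
    set B := yuE d (fun s => (yuP d l).eval s * χ s)
    set k := -(lam (t + 1) * c)
    by_contra hneg
    have hneg := not_le.1 hneg
    have h3 : k * (B * B) = (lam (t + 1) - lam l) * (A * B) := by rw [← mul_assoc, ← h1]; ring
    have h4 : (lam (t + 1) - lam l) * (A * B) < 0 := mul_neg_of_neg_of_pos (by linarith) hneg
    have h5 : 0 ≤ k * (B * B) := mul_nonneg hcneg.le (mul_self_nonneg _)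
    linarith
  · have hl3 : l = t + 1 := by omega
    subst hl3
    rw [sub_self, zero_mul] at h1
    rcases mul_eq_zero.1 h1.symm with h2 | h2
    · exact absurd h2 hcneg.ne'
    · rw [h2, mul_zero]

end Specific
/-- Yudin's bound.  Let `α_t` be the largest zero of the derivative of
`P_{t+1}^{(d)}`.  Then every spherical `t`-design with `N` points on `S^d` satisfies
`N ≥ ∫_{-1}^{1} (1-x²)^{d/2-1} dx / ∫_{α_t}^{1} (1-x²)^{d/2-1} dx`. -/
theorem yudin_lower_bound (d t N : ℕ) (hd : 1 ≤ d) (α : ℝ)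
    (hαzero : deriv (legendreP d (t + 1)) α = 0)
    (hαmax : ∀ x : ℝ, deriv (legendreP d (t + 1)) x = 0 → x ≤ α)
    (X : Finset (EuclideanSpace ℝ (Fin (d + 1)))) (hcard : X.card = N)
    (hXsphere : ∀ x ∈ X, ‖x‖ = 1)
    (hdesign : IsSphericalDesign d t X) :
    (∫ x in (-1 : ℝ)..1, (1 - x ^ 2) ^ ((d : ℝ) / 2 - 1)) /
      (∫ x in α..1, (1 - x ^ 2) ^ ((d : ℝ) / 2 - 1)) ≤ (N : ℝ) := by
  have he : legendreP d (t + 1) = fun x => (yuP d (t + 1)).eval x := funext (yuP_eval d (t + 1))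
  rw [he, Polynomial.deriv] at hαzero
  simp only [he, Polynomial.deriv] at hαmax
  obtain ⟨⟨h1, h2⟩, h3⟩ := yu_spec hd t α hαzero hαmax hXsphere hdesign
  rw [hcard] at h3
  have hW := yuW_pos d hd
  have hV : 0 < ∫ s in α..1, yuw d s :=
    intervalIntegral.intervalIntegral_pos_of_pos_on (yuw_int_sub d hd ⟨h1.le, h2.le⟩ (by norm_num))
      (fun s hs => yuw_pos d (by linarith [hs.1]) hs.2) h2
  change yuW d / (∫ s in α..1, yuw d s) ≤ (N : ℝ)
  rw [div_le_iff₀ hV]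
  have h4 : yuW d * 1 ≤ yuW d * ((N : ℝ) * ((yuW d)⁻¹ * ∫ s in α..1, yuw d s)) :=
    mul_le_mul_of_nonneg_left h3 hW.le
  have h5 : yuW d * ((N : ℝ) * ((yuW d)⁻¹ * ∫ s in α..1, yuw d s)) = N * ∫ s in α..1, yuw d s := by
    field_simp
  linarith
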